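/- arXiv:1008.1053 — 17 statements merged into one kernel-verified Lean document; each statement's English description precedes it below -/
import Mathlib

section
/- If a closed disk D in the Euclidean plane contains two points p and q, then there exists a closed disk contained in D whose bounding circle passes through both p and q. Formally: for all c ∈ ℝ², r ≥ 0 and p, q ∈ Metric.closedBall c r, there exist c' ∈ ℝ² and r' ≥ 0 with Metric.closedBall c' r' ⊆ Metric.closedBall c r, p ∈ Metric.sphere c' r' and q ∈ Metric.sphere c' r'. -/
theorem shrunken_aux (c : EuclideanSpace ℝ (Fin 2)) (r : ℝ)
    (p q : EuclideanSpace ℝ (Fin 2))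
    (hp : dist p c ≤ r) (h : dist q c ≤ dist p c) :
    ∃ (c' : EuclideanSpace ℝ (Fin 2)) (r' : ℝ), 0 ≤ r' ∧
      Metric.closedBall c' r' ⊆ Metric.closedBall c r ∧
      p ∈ Metric.sphere c' r' ∧ q ∈ Metric.sphere c' r' := by
  let g : ℝ → EuclideanSpace ℝ (Fin 2) := fun t => AffineMap.lineMap c p t
  have hg : Continuous g := AffineMap.lineMap_continuous
  have hf : ContinuousOn (fun t => dist q (g t) - dist p (g t)) (Set.Icc 0 1) := by
    fun_prop
  have h0 : (0:ℝ) ∈ Set.Icc (dist q (g 0) - dist p (g 0)) (dist q (g 1) - dist p (g 1)) := by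
    simp [g, h]
  obtain ⟨t, ht, hte⟩ := intermediate_value_Icc zero_le_one hf h0
  refine ⟨g t, dist p (g t), dist_nonneg, ?_, Metric.mem_sphere.2 rfl, ?_⟩
  · apply Metric.closedBall_subset_closedBall'
    have h1 : dist p (g t) = (1 - t) * dist c p := by
      simp only [g]
      rw [dist_right_lineMap, Real.norm_of_nonneg (by linarith [ht.2])]
    have h2 : dist (g t) c = t * dist c p := by
      simp only [g]
      rw [dist_lineMap_left, Real.norm_of_nonneg ht.1]
    rw [h1, h2]
    rw [dist_comm] at hp
    linarith
  · simp only [Metric.mem_sphere]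
    simp only at hte
    linarith


/-- If a closed disk contains two points `p` and `q`, then there exists a closed
disk contained in it whose bounding circle passes through both `p` and `q`. -/
theorem shrunken_disk (c : EuclideanSpace ℝ (Fin 2)) (r : ℝ) (hr : 0 ≤ r)
    (p q : EuclideanSpace ℝ (Fin 2))
    (hp : p ∈ Metric.closedBall c r) (hq : q ∈ Metric.closedBall c r) :
    ∃ (c' : EuclideanSpace ℝ (Fin 2)) (r' : ℝ), 0 ≤ r' ∧
      Metric.closedBall c' r' ⊆ Metric.closedBall c r ∧
      p ∈ Metric.sphere c' r' ∧ q ∈ Metric.sphere c' r' := by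
  rcases le_total (dist q c) (dist p c) with h | h
  · exact shrunken_aux c r p q hp h
  · obtain ⟨c', r', h1, h2, h3, h4⟩ := shrunken_aux c r q p hq h
    exact ⟨c', r', h1, h2, h4, h3⟩
end

section
/- Let W be a finite set of points in the Euclidean plane, and let p ≠ q be two points such that W \ {p,q} is nonempty and no point of W \ {p,q} is collinear with p and q. Define V(p) = {x ∈ ℝ² : dist(x,p) ≤ dist(x,w) for all w ∈ W} and similarly V(q). Then p and q are adjacent in the witness Delaunay graph with respect to W (i.e., there exist c and r with dist(c,p) = dist(c,q) = r and dist(c,w) ≥ r for all w ∈ W) if and only if frontier(V(p)) ∩ frontier(V(q)) is nonempty. -/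
lemma wd_dist_le (x a b : EuclideanSpace ℝ (Fin 2)) : dist x a ≤ dist x b ↔
    (x 0 - a 0)^2 + (x 1 - a 1)^2 ≤ (x 0 - b 0)^2 + (x 1 - b 1)^2 := by
  rw [EuclideanSpace.dist_eq, EuclideanSpace.dist_eq, Real.sqrt_le_sqrt_iff (by positivity)]
  simp [Fin.sum_univ_two, Real.dist_eq, sq_abs]

lemma wd_closed (W : Finset (EuclideanSpace ℝ (Fin 2))) (p : EuclideanSpace ℝ (Fin 2)) :
    IsClosed {x : EuclideanSpace ℝ (Fin 2) | ∀ w ∈ W, dist x p ≤ dist x w} := by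
  simp only [Set.setOf_forall]
  exact isClosed_biInter fun w _ => isClosed_le (by fun_prop) (by fun_prop)

lemma wd_frontier (W : Finset (EuclideanSpace ℝ (Fin 2))) (p x : EuclideanSpace ℝ (Fin 2)) :
    x ∈ frontier {x : EuclideanSpace ℝ (Fin 2) | ∀ w ∈ W, dist x p ≤ dist x w} ↔
    (∀ w ∈ W, dist x p ≤ dist x w) ∧ ∃ w ∈ W, w ≠ p ∧ dist x p = dist x w := by
  rw [(wd_closed W p).frontier_eq]
  constructor
  · rintro ⟨hx, hi⟩
    refine ⟨hx, ?_⟩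
    by_contra! hne
    apply hi
    rw [mem_interior_iff_mem_nhds]
    have : ∀ w ∈ W, ∀ᶠ y in nhds x, dist y p ≤ dist y w := by
      intro w hw
      by_cases h : w = p
      · subst h; exact Filter.Eventually.of_forall fun _ => le_rfl
      · have hlt : dist x p < dist x w := lt_of_le_of_ne (hx w hw) (hne w hw h)
        have ho : IsOpen {y : EuclideanSpace ℝ (Fin 2) | dist y p < dist y w} :=
          isOpen_lt (by fun_prop) (by fun_prop)
        filter_upwards [ho.mem_nhds hlt] with y hy using le_of_lt hy
    exact (Filter.eventually_all_finset W).2 this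
  · rintro ⟨hx, w, hw, hne, he⟩
    refine ⟨hx, fun hi => ?_⟩
    rw [mem_interior_iff_mem_nhds] at hi
    have hc : Filter.Tendsto (fun t : ℝ => x + t • (w - p)) (nhdsWithin 0 (Set.Ioi 0)) (nhds x) := by
      have : Continuous (fun t : ℝ => x + t • (w - p)) := by fun_prop
      have h := this.tendsto 0
      simp only [zero_smul, add_zero] at h
      exact h.mono_left nhdsWithin_le_nhds
    obtain ⟨t, ht, ht0⟩ := ((hc.eventually hi).and self_mem_nhdsWithin).exists
    have h1 := (wd_dist_le _ _ _).1 (ht w hw)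
    have h2 := (wd_dist_le _ _ _).1 he.ge
    simp only [PiLp.add_apply, PiLp.smul_apply, PiLp.sub_apply, smul_eq_mul] at h1
    have ht0 : 0 < t := ht0
    have h3 : t * ((w 0 - p 0)^2 + (w 1 - p 1)^2) ≤ 0 := by nlinarith
    have h4 : (w 0 - p 0)^2 + (w 1 - p 1)^2 ≤ 0 := by
      by_contra! h
      nlinarith [mul_pos ht0 h]
    apply hne
    ext i
    fin_cases i
    · show w 0 = p 0
      nlinarith [sq_nonneg (w 1 - p 1), sq_nonneg (w 0 - p 0)]
    · show w 1 = p 1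
      nlinarith [sq_nonneg (w 1 - p 1), sq_nonneg (w 0 - p 0)]

lemma wd_col (p q w : EuclideanSpace ℝ (Fin 2)) (hpq : p ≠ q)
    (h : (q 0 - p 0) * (w 1 - p 1) = (q 1 - p 1) * (w 0 - p 0)) :
    Collinear ℝ ({p, q, w} : Set (EuclideanSpace ℝ (Fin 2))) := by
  rw [collinear_iff_of_mem (p₀ := p) (by simp)]
  have hd : (q 0 - p 0)^2 + (q 1 - p 1)^2 ≠ 0 := by
    intro h0
    apply hpq
    ext i
    fin_cases i
    · show p 0 = q 0
      nlinarith [sq_nonneg (q 1 - p 1), sq_nonneg (q 0 - p 0)]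
    · show p 1 = q 1
      nlinarith [sq_nonneg (q 1 - p 1), sq_nonneg (q 0 - p 0)]
  refine ⟨q - p, ?_⟩
  simp only [Set.mem_insert_iff, Set.mem_singleton_iff, forall_eq_or_imp, forall_eq]
  refine ⟨⟨0, by simp⟩, ⟨1, by simp⟩,
    ⟨((q 0 - p 0) * (w 0 - p 0) + (q 1 - p 1) * (w 1 - p 1)) /
      ((q 0 - p 0)^2 + (q 1 - p 1)^2), ?_⟩⟩
  ext i
  fin_cases i
  · simp only [vadd_eq_add, PiLp.add_apply, PiLp.smul_apply, PiLp.sub_apply, smul_eq_mul]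
    show w 0 = _ * (q 0 - p 0) + p 0
    field_simp
    linear_combination (-(q 1 - p 1)) * h
  · simp only [vadd_eq_add, PiLp.add_apply, PiLp.smul_apply, PiLp.sub_apply, smul_eq_mul]
    show w 1 = _ * (q 1 - p 1) + p 1
    field_simp
    linear_combination (q 0 - p 0) * h

lemma wd_affine {ι : Type*} (W : Finset ι) (a b : ι → ℝ) (w0 : ι) (hw0 : w0 ∈ W)
    (ha : ∀ w ∈ W, 0 ≤ a w) (hb : b w0 < 0) :
    ∃ t : ℝ, (∀ w ∈ W, 0 ≤ a w + t * b w) ∧ ∃ w ∈ W, b w < 0 ∧ a w + t * b w = 0 := by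
  classical
  obtain ⟨m, hm, hmin⟩ := (W.filter (fun w => b w < 0)).exists_min_image (fun w => a w / (- b w))
    ⟨w0, by simp [hw0, hb]⟩
  simp only [Finset.mem_filter] at hm hmin
  have hbm := hm.2
  have ht : 0 ≤ a m / (- b m) := div_nonneg (ha m hm.1) (by linarith)
  refine ⟨a m / (- b m), fun w hw => ?_, m, hm.1, hm.2, ?_⟩
  · by_cases h : b w < 0
    · have h1 := hmin w ⟨hw, h⟩
      rw [le_div_iff₀ (by linarith)] at h1
      linarith
    · have := mul_nonneg ht (not_lt.1 h)
      have := ha w hw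
      linarith
  · have : b m ≠ 0 := hbm.ne
    field_simp
    ring


/-- Two distinct points `p` and `q` are adjacent in the witness Delaunay graph
`DG⁻(·, W)` if and only if the frontiers of their Voronoi cells (in
`Vor(W ∪ {p})` and `Vor(W ∪ {q})` respectively) meet, provided that
`W \ {p,q}` is nonempty and no witness other than `p, q` is collinear with
`p` and `q`. -/
theorem witnessDelaunay_adj_iff_voronoi_frontiers_meet
    (W : Finset (EuclideanSpace ℝ (Fin 2)))
    (p q : EuclideanSpace ℝ (Fin 2)) (hpq : p ≠ q)
    (hW : ∃ w ∈ W, w ≠ p ∧ w ≠ q)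
    (hcol : ∀ w ∈ W, w ≠ p → w ≠ q →
      ¬ Collinear ℝ ({p, q, w} : Set (EuclideanSpace ℝ (Fin 2)))) :
    (∃ (c : EuclideanSpace ℝ (Fin 2)) (r : ℝ),
        dist c p = r ∧ dist c q = r ∧ ∀ w ∈ W, r ≤ dist c w) ↔
      (frontier {x : EuclideanSpace ℝ (Fin 2) | ∀ w ∈ W, dist x p ≤ dist x w} ∩
        frontier {x : EuclideanSpace ℝ (Fin 2) | ∀ w ∈ W, dist x q ≤ dist x w}).Nonempty := by
  simp only [Set.Nonempty, Set.mem_inter_iff, wd_frontier]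
  constructor
  · rintro ⟨c, r, hp, hq, hr⟩
    obtain ⟨w0, hw0, hw0p, hw0q⟩ := hW
    have hB : ∀ w ∈ W, w ≠ p → w ≠ q →
        (q 0 - p 0) * (w 1 - p 1) - (q 1 - p 1) * (w 0 - p 0) ≠ 0 :=
      fun w hw h1 h2 h => hcol w hw h1 h2 (wd_col p q w hpq (by linarith))
    set B : EuclideanSpace ℝ (Fin 2) → ℝ :=
      fun w => (q 0 - p 0) * (w 1 - p 1) - (q 1 - p 1) * (w 0 - p 0) with hBdef
    set A : EuclideanSpace ℝ (Fin 2) → ℝ := fun w =>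
      (c 0 - w 0)^2 + (c 1 - w 1)^2 - ((c 0 - p 0)^2 + (c 1 - p 1)^2) with hAdef
    have hA : ∀ w ∈ W, 0 ≤ A w := by
      intro w hw
      have := (wd_dist_le c p w).1 (hp.trans_le (hr w hw))
      simp only [hAdef]; linarith
    have hb0 : - (B w0) * B w0 < 0 := by
      have : 0 < B w0 * B w0 := mul_self_pos.2 (hB w0 hw0 hw0p hw0q)
      linarith
    obtain ⟨t, ht, m, hm, hbm, he⟩ :=
      wd_affine W A (fun w => - (B w0) * B w) w0 hw0 hA hb0
    have hBm : B m ≠ 0 := fun h => by simp [h] at hbm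
    have hmp : m ≠ p := by
      rintro rfl; apply hBm; simp only [hBdef]; ring
    have hmq : m ≠ q := by
      rintro rfl; apply hBm; simp only [hBdef]; ring
    have hpq1 := (wd_dist_le c p q).1 (by rw [hp, hq])
    have hpq2 := (wd_dist_le c q p).1 (by rw [hp, hq])
    have hpqe := le_antisymm hpq1 hpq2
    obtain ⟨s, hs⟩ : ∃ s, s = t * B w0 / 2 := ⟨_, rfl⟩
    set x : EuclideanSpace ℝ (Fin 2) :=
      !₂[c 0 - s * (q 1 - p 1), c 1 + s * (q 0 - p 0)] with hx
    have hx0 : x 0 = c 0 - s * (q 1 - p 1) := by simp [hx]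
    have hx1 : x 1 = c 1 + s * (q 0 - p 0) := by simp [hx]
    have key : ∀ w, (x 0 - w 0)^2 + (x 1 - w 1)^2 - ((x 0 - p 0)^2 + (x 1 - p 1)^2)
        = A w + t * (- (B w0) * B w) := by
      intro w
      have : t * (- (B w0) * B w) = - 2 * s * B w := by rw [hs]; ring
      rw [this, hx0, hx1]; simp only [hAdef, hBdef]; ring
    have hxq : dist x p = dist x q := by
      apply le_antisymm <;> rw [wd_dist_le, hx0, hx1] <;> apply le_of_eq
      · linear_combination hpqe
      · linear_combination -hpqe
    have hle : ∀ w ∈ W, dist x p ≤ dist x w := by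
      intro w hw
      rw [wd_dist_le]
      have h1 := key w
      have h2 := ht w hw
      linarith
    have hme : dist x p = dist x m := by
      have h1 := key m
      apply le_antisymm <;> rw [wd_dist_le] <;> linarith
    exact ⟨x, ⟨hle, m, hm, hmp, hme⟩, fun w hw => hxq ▸ hle w hw, m, hm, hmq, hxq ▸ hme⟩
  · rintro ⟨x, ⟨h1, w1, hw1, _, e1⟩, h2, w2, hw2, _, e2⟩
    have he : dist x q = dist x p :=
      le_antisymm (e1 ▸ h2 w1 hw1) (e2 ▸ h1 w2 hw2)
    exact ⟨x, dist x p, rfl, he, h1⟩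
end

section
/- Every finite tree can be realized as a witness Delaunay graph: for every simple graph T on a finite nonempty vertex type V such that T is a tree, there exist an injective map f : V → ℝ² and a finite set W ⊂ ℝ² such that for all distinct u, v ∈ V, u and v are adjacent in T if and only if there exist c ∈ ℝ² and r ≥ 0 with dist(c, f u) = dist(c, f v) = r and dist(c, w) ≥ r for every w ∈ W. -/
/-- Squared Euclidean distance in coordinates. -/
def sqD (x y : ℝ × ℝ) : ℝ := (x.1 - y.1) ^ 2 + (x.2 - y.2) ^ 2

lemma sqD_nonneg (x y : ℝ × ℝ) : 0 ≤ sqD x y := by unfold sqD; positivity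

lemma sqD_pos {x y : ℝ × ℝ} (h : x ≠ y) : 0 < sqD x y := by
  rcases (sqD_nonneg x y).lt_or_eq with h' | h'
  · exact h'
  · exfalso
    apply h
    unfold sqD at h'
    have h1 : (x.1 - y.1) ^ 2 = 0 := by nlinarith [sq_nonneg (x.1 - y.1), sq_nonneg (x.2 - y.2)]
    have h2 : (x.2 - y.2) ^ 2 = 0 := by nlinarith [sq_nonneg (x.1 - y.1), sq_nonneg (x.2 - y.2)]
    have h1' := pow_eq_zero_iff (two_ne_zero) |>.1 h1
    have h2' := pow_eq_zero_iff (two_ne_zero) |>.1 h2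
    exact Prod.ext (by linarith) (by linarith)

lemma sqD_tri (c p x : ℝ × ℝ) (h : sqD c x = sqD c p) : sqD p x ≤ 4 * sqD c p := by
  unfold sqD at *
  nlinarith [sq_nonneg (p.1 + x.1 - 2 * c.1), sq_nonneg (p.2 + x.2 - 2 * c.2)]

/-- The three blocking witnesses. -/
noncomputable def wit (p C : ℝ × ℝ) (η : ℝ) (i : Fin 3) : ℝ × ℝ :=
  match i with
  | 0 => (p.1 + (η ^ 2 / 2 * (C.1 - p.1) - η * (C.2 - p.2)),
          p.2 + (η ^ 2 / 2 * (C.2 - p.2) + η * (C.1 - p.1)))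
  | 1 => (p.1 + (η ^ 2 / 2 * (C.1 - p.1) + η * (C.2 - p.2)),
          p.2 + (η ^ 2 / 2 * (C.2 - p.2) - η * (C.1 - p.1)))
  | 2 => (p.1 - η * (C.1 - p.1), p.2 - η * (C.2 - p.2))

lemma wit_zero (p C : ℝ × ℝ) (i : Fin 3) : wit p C 0 i = p := by
  fin_cases i <;> simp [wit]

lemma wit_cont (p C : ℝ × ℝ) (i : Fin 3) : Continuous fun η => wit p C η i := by
  fin_cases i <;> simp only [wit] <;> fun_prop

lemma wit_out (p C : ℝ × ℝ) (η : ℝ) (hη : 0 < η) (i : Fin 3) :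
    sqD C p ≤ sqD C (wit p C η i) := by
  have h : 0 ≤ sqD C p := sqD_nonneg _ _
  have e : ∀ t : ℝ, 0 ≤ t → 0 ≤ t * sqD C p := fun t ht => mul_nonneg ht h
  fin_cases i <;> simp only [wit]
  · have := e (η ^ 4 / 4) (by positivity)
    unfold sqD at *; nlinarith
  · have := e (η ^ 4 / 4) (by positivity)
    unfold sqD at *; nlinarith
  · have := e (2 * η + η ^ 2) (by positivity)
    unfold sqD at *; nlinarith

lemma wit_block (p C c : ℝ × ℝ) (η : ℝ) (hη : 0 < η) (hη1 : η ≤ 1) (hne : C ≠ p)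
    (h : ∀ i, sqD c p ≤ sqD c (wit p C η i)) : sqD c p ≤ 4 * sqD C p := by
  have hR := sqD_pos hne
  set R := sqD C p with hRdef
  set A := (c.1 - p.1) * (C.1 - p.1) + (c.2 - p.2) * (C.2 - p.2) with hA
  set B := - (c.1 - p.1) * (C.2 - p.2) + (c.2 - p.2) * (C.1 - p.1) with hB
  have hAB : A ^ 2 + B ^ 2 = sqD c p * R := by
    rw [hA, hB, hRdef]; unfold sqD; ring
  have h0 : η * (η * A + 2 * B) ≤ η * ((η ^ 3 / 4 + η) * R) := by
    have := h 0
    simp only [wit] at this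
    rw [hA, hB, hRdef]; unfold sqD at *; nlinarith
  have h1 : η * (η * A - 2 * B) ≤ η * ((η ^ 3 / 4 + η) * R) := by
    have := h 1
    simp only [wit] at this
    rw [hA, hB, hRdef]; unfold sqD at *; nlinarith
  have h2 : η * (-2 * A) ≤ η * (η * R) := by
    have := h 2
    simp only [wit] at this
    rw [hA, hRdef]; unfold sqD at *; nlinarith
  replace h0 := le_of_mul_le_mul_left h0 hη
  replace h1 := le_of_mul_le_mul_left h1 hη
  replace h2 := le_of_mul_le_mul_left h2 hη
  clear_value R A B
  clear hRdef hA hB h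
  have hη2 : η ^ 2 ≤ 1 := pow_le_one₀ hη.le hη1
  have hη3 : η ^ 3 ≤ 1 := pow_le_one₀ hη.le hη1
  have hRη : η * R ≤ R := by nlinarith
  have hA1 : A ≤ 5 / 4 * R := by
    have : η * A ≤ η * ((η ^ 2 / 4 + 1) * R) := by
      have e : η * ((η ^ 2 / 4 + 1) * R) = (η ^ 3 / 4 + η) * R := by ring
      rw [e]; linarith
    have := le_of_mul_le_mul_left this hη
    nlinarith
  have hA2 : -(R / 2) ≤ A := by linarith
  have hA3 : -(R / 2) ≤ η * A := by
    have : η * (-(R / 2)) ≤ η * A := mul_le_mul_of_nonneg_left hA2 hη.le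
    nlinarith
  have hS : (η ^ 3 / 4 + η) * R ≤ 5 / 4 * R := by
    apply mul_le_mul_of_nonneg_right _ hR.le; linarith
  have hB1 : B ≤ R := by linarith
  have hB2 : -R ≤ B := by linarith
  have : sqD c p * R ≤ (4 * R) * R := by
    rw [← hAB]
    have q1 : A ^ 2 ≤ (5 / 4 * R) ^ 2 := sq_le_sq' (by linarith) hA1
    have q2 : B ^ 2 ≤ R ^ 2 := sq_le_sq' hB2 hB1
    nlinarith
  exact le_of_mul_le_mul_right this hR

open Filter Topology in
lemma ev_pos {g : ℝ → ℝ} (hg : Continuous g) (u : ℝ) (h : u < g 0) :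
    ∀ᶠ t in 𝓝[>] (0:ℝ), u < g t :=
  ((hg.tendsto 0).eventually_const_lt h).filter_mono nhdsWithin_le_nhds

open Filter Topology in
lemma geom_step (F W : Finset (ℝ × ℝ)) (K : Finset ((ℝ × ℝ) × ℝ)) (a : ℝ × ℝ)
    (hK : ∀ k ∈ K, k.2 ≤ sqD k.1 a ∧ (sqD k.1 a = k.2 → k.1.2 < a.2)) :
    ∃ (p C : ℝ × ℝ) (N : Finset (ℝ × ℝ)),
      p ∉ F ∧ p ≠ a ∧ sqD C p = sqD C a ∧ C.2 < a.2 ∧ C.2 < p.2 ∧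
      (∀ k ∈ K, k.2 < sqD k.1 p) ∧
      (∀ k ∈ K, ∀ w ∈ N, k.2 ≤ sqD k.1 w) ∧
      (∀ x ∈ F, x ≠ a → sqD C a < sqD C x) ∧
      (∀ w ∈ W, sqD C a ≤ sqD C w) ∧
      (∀ w ∈ N, sqD C a ≤ sqD C w) ∧
      (∀ x ∈ F, x ≠ a → ∀ c, sqD c x = sqD c p → ∃ w ∈ N, sqD c w < sqD c p) := by
  classical
  -- choose δ
  have hδ : ∃ δ : ℝ, 0 < δ ∧ ∀ k ∈ K, sqD k.1 a = k.2 →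
      0 < δ * (a.1 - k.1.1) + (a.2 - k.1.2) := by
    have : ∀ᶠ δ in 𝓝[>] (0:ℝ), ∀ k ∈ K, sqD k.1 a = k.2 →
      0 < δ * (a.1 - k.1.1) + (a.2 - k.1.2) := by
      rw [Filter.eventually_all_finset]
      intro k hk
      by_cases h : sqD k.1 a = k.2
      · have h' := (hK k hk).2 h
        have hc : Continuous fun δ : ℝ => δ * (a.1 - k.1.1) + (a.2 - k.1.2) := by fun_prop
        have := ev_pos hc 0 (by simpa using h')
        exact this.mono fun _ h _ => h
      · exact Eventually.of_forall fun _ h1 => absurd h1 h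
    obtain ⟨δ, h1, h2⟩ := (this.and self_mem_nhdsWithin).exists
    exact ⟨δ, h2, h1⟩
  obtain ⟨δ, hδ0, hδK⟩ := hδ
  let P : ℝ → ℝ × ℝ := fun ε => (a.1 + ε * δ, a.2 + ε)
  let Q : ℝ → ℝ × ℝ := fun ε =>
    (a.1 + ε * (1 + δ ^ 2) / 2 * (2 / δ), a.2 - ε * (1 + δ ^ 2) / 2)
  have hP0 : P 0 = a := by simp [P]
  have hQ0 : Q 0 = a := by simp [Q]
  have hPc : Continuous P := by simp only [P]; fun_prop
  have hQc : Continuous Q := by simp only [Q]; fun_prop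
  have hPQ : ∀ ε, sqD (Q ε) (P ε) = sqD (Q ε) a := by
    intro ε
    simp only [P, Q, sqD]
    field_simp
    ring
  have aa : sqD a a = 0 := by simp [sqD]
  have e1 : ∀ᶠ ε in 𝓝[>] (0:ℝ), ∀ k ∈ K, k.2 < sqD k.1 (P ε) := by
    rw [Filter.eventually_all_finset]
    intro k hk
    by_cases h : sqD k.1 a = k.2
    · have h' := hδK k hk h
      filter_upwards [self_mem_nhdsWithin] with ε hε
      have hε : 0 < ε := hε
      rw [← h]
      simp only [sqD, P]
      have := mul_pos hε h'
      have : 0 < ε ^ 2 := by positivity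
      nlinarith [sq_nonneg (ε * δ)]
    · have h' : k.2 < sqD k.1 a := lt_of_le_of_ne (hK k hk).1 (Ne.symm h)
      have hc : Continuous fun ε => sqD k.1 (P ε) := by unfold sqD; fun_prop
      exact (ev_pos hc _ (by simpa [hP0] using h'))
  have e2 : ∀ᶠ ε in 𝓝[>] (0:ℝ), ∀ x ∈ F ∪ W, x ≠ a → sqD (Q ε) a < sqD (Q ε) x := by
    rw [Filter.eventually_all_finset]
    intro x hx
    by_cases h : x = a
    · exact Eventually.of_forall fun _ h1 => absurd h h1
    · have hc : Continuous fun ε => sqD (Q ε) x - sqD (Q ε) a := by unfold sqD; fun_prop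
      have := (ev_pos hc 0
        (by simpa [hQ0, aa] using sqD_pos (Ne.symm h)))
      exact this.mono fun _ h _ => by linarith
  have e3 : ∀ᶠ ε in 𝓝[>] (0:ℝ), ∀ x ∈ F, x ≠ a → 16 * sqD (Q ε) a < sqD (P ε) x := by
    rw [Filter.eventually_all_finset]
    intro x hx
    by_cases h : x = a
    · exact Eventually.of_forall fun _ h1 => absurd h h1
    · have hc : Continuous fun ε => sqD (P ε) x - 16 * sqD (Q ε) a := by unfold sqD; fun_prop
      have := (ev_pos hc 0
        (by simpa [hQ0, hP0, aa] using sqD_pos (Ne.symm h)))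
      exact this.mono fun _ h _ => by linarith
  obtain ⟨ε, ⟨⟨h1, h2⟩, h3⟩, hε⟩ := (((e1.and e2).and e3).and self_mem_nhdsWithin).exists
  have hε : 0 < ε := hε
  have hPQε := hPQ ε
  have hPa : a.2 < (P ε).2 := by simp only [P]; linarith
  have hQa : (Q ε).2 < a.2 := by
    simp only [Q]
    have : 0 < ε * (1 + δ ^ 2) / 2 := by positivity
    linarith
  generalize P ε = p at *
  generalize Q ε = C at *
  have hCp : C ≠ p := by
    intro h; rw [h] at hQa; linarith
  have hη : ∀ᶠ η in 𝓝[>] (0:ℝ), ∀ k ∈ K, ∀ i, k.2 < sqD k.1 (wit p C η i) := by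
    rw [Filter.eventually_all_finset]
    intro k hk
    rw [Filter.eventually_all]
    intro i
    have hw := wit_cont p C i
    have hc : Continuous fun η => sqD k.1 (wit p C η i) := by unfold sqD; fun_prop
    exact (ev_pos hc _
      (by simpa [wit_zero] using h1 k hk))
  have hle : ∀ᶠ η in 𝓝[>] (0:ℝ), η ≤ 1 :=
    (eventually_le_nhds (by norm_num)).filter_mono nhdsWithin_le_nhds
  obtain ⟨η, ⟨hηK, hη1⟩, hη0⟩ := ((hη.and hle).and self_mem_nhdsWithin).exists
  have hη0 : 0 < η := hη0
  have hpa : p ≠ a := by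
    intro h; rw [h] at hPa; exact lt_irrefl _ hPa
  refine ⟨p, C, Finset.univ.image (wit p C η), ?_, hpa, hPQε, hQa, hQa.trans hPa, h1, ?_, ?_, ?_,
    ?_, ?_⟩
  · intro hp
    have := h3 p hp hpa
    have h0 := sqD_nonneg C a
    simp only [sqD, sub_self] at this h0
    linarith
  · intro k hk w hw
    obtain ⟨i, -, rfl⟩ := Finset.mem_image.1 hw
    exact (hηK k hk i).le
  · intro x hx hxa
    exact h2 x (Finset.mem_union_left _ hx) hxa
  · intro w hw
    by_cases h : w = a
    · rw [h]
    · exact (h2 w (Finset.mem_union_right _ hw) h).le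
  · intro w hw
    obtain ⟨i, -, rfl⟩ := Finset.mem_image.1 hw
    rw [← hPQε]
    exact wit_out p C η hη0 i
  · intro x hx hxa c hc
    by_contra hcon
    push Not at hcon
    have hb := wit_block p C c η hη0 hη1 hCp
      (fun i => hcon _ (Finset.mem_image_of_mem _ (Finset.mem_univ i)))
    have := sqD_tri c p x hc
    have := h3 x hx hxa
    linarith

/-- Realization with the strengthened invariant. -/
def Good {V : Type*} (T : SimpleGraph V) : Prop :=
  ∃ (f : V → ℝ × ℝ) (W : Finset (ℝ × ℝ)) (K : Finset ((ℝ × ℝ) × ℝ)),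
    Function.Injective f ∧
    (∀ k ∈ K, ∀ w ∈ W, k.2 ≤ sqD k.1 w) ∧
    (∀ k ∈ K, ∀ v, k.2 ≤ sqD k.1 (f v) ∧ (sqD k.1 (f v) = k.2 → k.1.2 < (f v).2)) ∧
    (∀ u v, T.Adj u v → ∃ k ∈ K, sqD k.1 (f u) = k.2 ∧ sqD k.1 (f v) = k.2) ∧
    (∀ u v, u ≠ v → ¬ T.Adj u v → ∀ c, sqD c (f u) = sqD c (f v) →
      ∃ w ∈ W, sqD c w < sqD c (f v))

lemma good_step {V : Type*} [Fintype V] (T : SimpleGraph V) (l b : V) (hlb : T.Adj l b)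
    (huniq : ∀ y, T.Adj l y → y = b) (hG : Good (T.induce {l}ᶜ)) : Good T := by
  classical
  obtain ⟨f, W, K, hf, hKW, hKf, hadj, hnadj⟩ := hG
  have hbl : b ≠ l := hlb.ne'
  obtain ⟨p, C, N, hpF, hpa, hCp, hCa2, hCp2, hKp, hKN, hCF, hCW, hCN, hblock⟩ :=
    geom_step (Finset.univ.image f) W K (f ⟨b, hbl⟩) (fun k hk => hKf k hk _)
  let g : V → ℝ × ℝ := fun v => if h : v = l then p else f ⟨v, h⟩
  have gl : g l = p := by simp [g]
  have gn : ∀ v (h : v ≠ l), g v = f ⟨v, h⟩ := fun v h => by simp [g, h]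
  have hfF : ∀ v, f v ∈ Finset.univ.image f := fun v => Finset.mem_image_of_mem _ (Finset.mem_univ _)
  have hpf : ∀ v, f v ≠ p := fun v h => hpF (h ▸ hfF v)
  have key : ∀ v, v ≠ l → ¬ T.Adj l v → ∀ c, sqD c (g v) = sqD c p →
      ∃ w ∈ W ∪ N, sqD c w < sqD c p := by
    intro v hv hn c hc
    rw [gn v hv] at hc
    have : f ⟨v, hv⟩ ≠ f ⟨b, hbl⟩ := by
      intro h
      have h1 : v = b := congrArg Subtype.val (hf h)
      exact hn (h1 ▸ hlb)
    obtain ⟨w, hw, h⟩ := hblock _ (hfF _) this c hc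
    exact ⟨w, Finset.mem_union_right _ hw, h⟩
  refine ⟨g, W ∪ N, insert (C, sqD C (f ⟨b, hbl⟩)) K, ?_, ?_, ?_, ?_, ?_⟩
  · intro u v huv
    by_cases hu : u = l <;> by_cases hv : v = l
    · rw [hu, hv]
    · rw [hu, gl, gn v hv] at huv
      exact absurd huv.symm (hpf _)
    · rw [hv, gl, gn u hu] at huv
      exact absurd huv (hpf _)
    · rw [gn u hu, gn v hv] at huv
      exact congrArg Subtype.val (hf huv)
  · intro k hk w hw
    rcases Finset.mem_insert.1 hk with rfl | hk <;> rcases Finset.mem_union.1 hw with hw | hw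
    · exact hCW w hw
    · exact hCN w hw
    · exact hKW k hk w hw
    · exact hKN k hk w hw
  · intro k hk v
    rcases Finset.mem_insert.1 hk with rfl | hk <;> by_cases hv : v = l
    · rw [hv, gl]; exact ⟨hCp.ge, fun _ => hCp2⟩
    · rw [gn v hv]
      by_cases h : f ⟨v, hv⟩ = f ⟨b, hbl⟩
      · rw [h]; exact ⟨le_rfl, fun _ => hCa2⟩
      · have := hCF _ (hfF ⟨v, hv⟩) h
        exact ⟨this.le, fun h' => absurd h' this.ne'⟩
    · rw [hv, gl]; exact ⟨(hKp k hk).le, fun h' => absurd h' (hKp k hk).ne'⟩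
    · rw [gn v hv]; exact hKf k hk _
  · intro u v huv
    by_cases hu : u = l <;> by_cases hv : v = l
    · rw [hu, hv] at huv; exact absurd huv (T.loopless.irrefl l)
    · have : v = b := huniq v (hu ▸ huv)
      refine ⟨_, Finset.mem_insert_self _ _, ?_⟩
      subst this
      rw [hu, gl, gn v hv]; exact ⟨hCp, rfl⟩
    · have : u = b := huniq u (hv ▸ huv.symm)
      refine ⟨_, Finset.mem_insert_self _ _, ?_⟩
      subst this
      rw [hv, gl, gn u hu]; exact ⟨rfl, hCp⟩
    · obtain ⟨k, hk, h⟩ := hadj ⟨u, hu⟩ ⟨v, hv⟩ huv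
      rw [gn u hu, gn v hv]
      exact ⟨k, Finset.mem_insert_of_mem hk, h⟩
  · intro u v huv hn c hc
    by_cases hu : u = l <;> by_cases hv : v = l
    · exact absurd (hu.trans hv.symm) huv
    · rw [← hc]
      subst hu
      rw [gl] at hc ⊢
      exact key v hv hn c hc.symm
    · subst hv
      rw [gl] at hc ⊢
      exact key u hu (fun h => hn h.symm) c hc
    · rw [gn u hu, gn v hv] at hc
      rw [gn v hv]
      obtain ⟨w, hw, h⟩ := hnadj ⟨u, hu⟩ ⟨v, hv⟩ (fun h => huv (congrArg Subtype.val h)) hn c hc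
      exact ⟨w, Finset.mem_union_left _ hw, h⟩

lemma good_tree (n : ℕ) : ∀ (V : Type*) [Fintype V] (T : SimpleGraph V), T.IsTree →
    Fintype.card V = n → Good T := by
  classical
  induction n with
  | zero =>
    intro V _ T hT hc
    have := hT.connected.nonempty
    exact absurd hc Fintype.card_ne_zero
  | succ n ih =>
    intro V _ T hT hc
    rcases subsingleton_or_nontrivial V with hs | hn
    · refine ⟨fun _ => 0, ∅, ∅, Function.injective_of_subsingleton _, by simp, by simp, ?_, ?_⟩
      · intro u v h; exact absurd (Subsingleton.elim u v) h.ne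
      · intro u v h; exact absurd (Subsingleton.elim u v) h
    · obtain ⟨l, hl⟩ := hT.exists_vert_degree_one_of_nontrivial
      have hconn := hT.connected.induce_compl_singleton_of_degree_eq_one hl
      obtain ⟨b, hb, hu⟩ := SimpleGraph.degree_eq_one_iff_existsUnique_adj.1 hl
      refine good_step T l b hb hu (ih _ _ ⟨hconn, hT.isAcyclic.induce _⟩ ?_)
      rw [Fintype.card_compl_set]
      simp [hc]

lemma sqD_dist (x y : EuclideanSpace ℝ (Fin 2)) :
    sqD (x 0, x 1) (y 0, y 1) = dist x y ^ 2 := by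
  rw [EuclideanSpace.dist_eq, Real.sq_sqrt (by positivity)]
  simp [sqD, Fin.sum_univ_two, Real.dist_eq, sq_abs]

/-- Every finite tree can be realized as a witness Delaunay graph: there are an
injective placement `f` of the vertices in the plane and a finite witness set
`W` such that two distinct vertices are adjacent in the tree iff there is a
disk with both their images on its bounding circle whose open disk contains
no witness. -/
theorem tree_realizable_as_witnessDelaunay
    (V : Type*) [Fintype V] [Nonempty V] (T : SimpleGraph V) (hT : T.IsTree) :
    ∃ (f : V → EuclideanSpace ℝ (Fin 2)) (W : Finset (EuclideanSpace ℝ (Fin 2))),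
      Function.Injective f ∧
      ∀ u v : V, u ≠ v →
        (T.Adj u v ↔ ∃ (c : EuclideanSpace ℝ (Fin 2)) (r : ℝ), 0 ≤ r ∧
          dist c (f u) = r ∧ dist c (f v) = r ∧ ∀ w ∈ W, r ≤ dist c w) := by
  classical
  obtain ⟨f, W, K, hf, hKW, hKf, hadj, hnadj⟩ := good_tree _ V T hT rfl
  let E : ℝ × ℝ → EuclideanSpace ℝ (Fin 2) := fun x => !₂[x.1, x.2]
  have hE : ∀ x y, sqD x y = dist (E x) (E y) ^ 2 := by
    intro x y
    rw [← sqD_dist]; simp [E]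
  have hEs : ∀ c, ∃ x, E x = c := by
    intro c
    refine ⟨(c 0, c 1), ?_⟩
    ext i; fin_cases i <;> simp [E]
  refine ⟨E ∘ f, W.image E, ?_, ?_⟩
  · refine Function.Injective.comp ?_ hf
    intro x y h
    have h0 := congrArg (fun z : EuclideanSpace ℝ (Fin 2) => z 0) h
    have h1 := congrArg (fun z : EuclideanSpace ℝ (Fin 2) => z 1) h
    exact Prod.ext (by simpa [E] using h0) (by simpa [E] using h1)
  · intro u v huv
    constructor
    · intro h
      obtain ⟨k, hk, h1, h2⟩ := hadj u v h
      refine ⟨E k.1, dist (E k.1) (E (f u)), dist_nonneg, rfl, ?_, ?_⟩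
      · have : dist (E k.1) (E (f v)) ^ 2 = dist (E k.1) (E (f u)) ^ 2 := by
          rw [← hE, ← hE, h1, h2]
        exact (sq_eq_sq₀ dist_nonneg dist_nonneg).1 this
      · intro w hw
        obtain ⟨w, hw', rfl⟩ := Finset.mem_image.1 hw
        apply (sq_le_sq₀ dist_nonneg dist_nonneg).1
        rw [← hE, ← hE, h1]
        exact hKW k hk w hw'
    · rintro ⟨c, r, hr, h1, h2, h3⟩
      by_contra hn
      obtain ⟨c, rfl⟩ := hEs c
      simp only [Function.comp] at h1 h2
      obtain ⟨w, hw, h⟩ := hnadj u v huv hn c (by rw [hE, hE, h1, h2])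
      rw [hE, hE, h2] at h
      have := h3 _ (Finset.mem_image_of_mem E hw)
      have := (sq_le_sq₀ hr dist_nonneg).2 this
      linarith
end

section
/- Let W be a finite set of points in the Euclidean plane and let p₁, p₂, q₁, q₂ be four distinct points such that no three of them are collinear, the four points do not lie on a common circle, and the open segments (p₁,q₁) and (p₂,q₂) intersect. If both pairs {p₁,q₁} and {p₂,q₂} are adjacent in the witness Delaunay graph with respect to W, then at least one of the pairs {p₁,p₂} or {q₁,q₂} is also adjacent in the witness Delaunay graph with respect to W. (Consequently, a bipartite witness Delaunay graph, with p's and q's in different parts, has a straight-line plane drawing, so no non-planar bipartite graph is realizable as a witness Delaunay graph.) -/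
/-- Adjacency in the witness Delaunay graph `DG⁻(·, W)`: there is a disk with
`x` and `y` on its bounding circle whose open disk contains no witness. -/
def WDGAdj (W : Finset (EuclideanSpace ℝ (Fin 2)))
    (x y : EuclideanSpace ℝ (Fin 2)) : Prop :=
  ∃ (c : EuclideanSpace ℝ (Fin 2)) (r : ℝ),
    dist c x = r ∧ dist c y = r ∧ ∀ w ∈ W, r ≤ dist c w

theorem dsq (x y : EuclideanSpace ℝ (Fin 2)) :
    dist x y ^ 2 = (x 0 - y 0) ^ 2 + (x 1 - y 1) ^ 2 := by
  rw [EuclideanSpace.dist_eq, Real.sq_sqrt (by positivity)]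
  simp [Fin.sum_univ_two, Real.dist_eq, sq_abs]

theorem aff (c d x y : EuclideanSpace ℝ (Fin 2)) (a b : ℝ) (h : a + b = 1) :
    dist c (a • x + b • y) ^ 2 - dist d (a • x + b • y) ^ 2 =
      a * (dist c x ^ 2 - dist d x ^ 2) + b * (dist c y ^ 2 - dist d y ^ 2) := by
  obtain rfl : b = 1 - a := by linarith
  simp only [dsq, PiLp.add_apply, PiLp.smul_apply, smul_eq_mul]
  ring

theorem shrink (W : Finset (EuclideanSpace ℝ (Fin 2))) (c x y : EuclideanSpace ℝ (Fin 2))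
    (hxy : x ≠ y) (hy : dist c y ≤ dist c x) (hW : ∀ w ∈ W, dist c x ≤ dist c w) :
    WDGAdj W x y := by
  set k : ℝ := (c 0 - x 0) * (y 0 - x 0) + (c 1 - x 1) * (y 1 - x 1) with hk
  have hpos : 0 < dist x y ^ 2 := by
    have := dist_pos.2 hxy
    positivity
  have hle : dist x y ^ 2 ≤ 2 * k := by
    have h : dist c y ^ 2 ≤ dist c x ^ 2 := by gcongr
    simp only [dsq] at h ⊢
    rw [hk]
    linarith
  have hk0 : 0 < 2 * k := by linarith
  obtain ⟨t, ht⟩ : ∃ t : ℝ, t = dist x y ^ 2 / (2 * k) := ⟨_, rfl⟩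
  have ht0 : 0 ≤ t := by rw [ht]; positivity
  have ht1 : t ≤ 1 := by rw [ht, div_le_one hk0]; exact hle
  have htk : t * (2 * k) = dist x y ^ 2 := by rw [ht, div_mul_cancel₀ _ hk0.ne']
  have e1 : dist (x + t • (c - x)) x = t * dist c x := by
    rw [dist_eq_norm, dist_eq_norm, add_sub_cancel_left, norm_smul, Real.norm_of_nonneg ht0]
  have e2 : dist c (x + t • (c - x)) = (1 - t) * dist c x := by
    rw [dist_eq_norm, dist_eq_norm,
      show c - (x + t • (c - x)) = (1 - t) • (c - x) by module, norm_smul,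
      Real.norm_of_nonneg (by linarith)]
  refine ⟨x + t • (c - x), t * dist c x, e1, ?_, ?_⟩
  · rw [← e1]
    rw [← sq_eq_sq₀ dist_nonneg dist_nonneg]
    simp only [dsq, PiLp.add_apply, PiLp.smul_apply, PiLp.sub_apply, smul_eq_mul] at htk ⊢
    rw [hk] at htk
    linarith
  · intro w hw
    have := hW w hw
    have := dist_triangle c (x + t • (c - x)) w
    linarith

theorem WDGAdj.swap {W : Finset (EuclideanSpace ℝ (Fin 2))} {x y : EuclideanSpace ℝ (Fin 2)}
    (h : WDGAdj W x y) : WDGAdj W y x := by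
  obtain ⟨c, r, a, b, d⟩ := h
  exact ⟨c, r, b, a, d⟩

/-- If the edges `p₁q₁` and `p₂q₂` of a witness Delaunay graph cross (the four
endpoints being distinct, with no three collinear and not concyclic), then
`p₁p₂` or `q₁q₂` is also an edge of the witness Delaunay graph. -/
theorem witnessDelaunay_crossing (W : Finset (EuclideanSpace ℝ (Fin 2)))
    (p₁ p₂ q₁ q₂ : EuclideanSpace ℝ (Fin 2))
    (hd : p₁ ≠ p₂ ∧ p₁ ≠ q₁ ∧ p₁ ≠ q₂ ∧ p₂ ≠ q₁ ∧ p₂ ≠ q₂ ∧ q₁ ≠ q₂)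
    (hcol : ∀ x ∈ ({p₁, p₂, q₁, q₂} : Set (EuclideanSpace ℝ (Fin 2))),
      ∀ y ∈ ({p₁, p₂, q₁, q₂} : Set (EuclideanSpace ℝ (Fin 2))),
      ∀ z ∈ ({p₁, p₂, q₁, q₂} : Set (EuclideanSpace ℝ (Fin 2))),
        x ≠ y → x ≠ z → y ≠ z → ¬ Collinear ℝ ({x, y, z} : Set (EuclideanSpace ℝ (Fin 2))))
    (hcirc : ¬ ∃ (c : EuclideanSpace ℝ (Fin 2)) (r : ℝ),
      p₁ ∈ Metric.sphere c r ∧ p₂ ∈ Metric.sphere c r ∧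
      q₁ ∈ Metric.sphere c r ∧ q₂ ∈ Metric.sphere c r)
    (hcross : (openSegment ℝ p₁ q₁ ∩ openSegment ℝ p₂ q₂).Nonempty)
    (h₁ : WDGAdj W p₁ q₁) (h₂ : WDGAdj W p₂ q₂) :
    WDGAdj W p₁ p₂ ∨ WDGAdj W q₁ q₂ := by
  obtain ⟨hp, -, -, -, -, hq⟩ := hd
  obtain ⟨c, r, hc1, hc2, hcW⟩ := h₁
  obtain ⟨d, s, hd1, hd2, hdW⟩ := h₂
  by_contra hcon
  rw [not_or] at hcon
  obtain ⟨n1, n2⟩ := hcon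
  have a1 : r < dist c p₂ := by
    by_contra! h
    exact n1 (shrink W c p₁ p₂ hp (by rwa [hc1]) (by rwa [hc1]))
  have a2 : r < dist c q₂ := by
    by_contra! h
    exact n2 (shrink W c q₁ q₂ hq (by rwa [hc2]) (by rwa [hc2]))
  have a3 : s < dist d p₁ := by
    by_contra! h
    exact n1 (shrink W d p₂ p₁ hp.symm (by rwa [hd1]) (by rwa [hd1])).swap
  have a4 : s < dist d q₁ := by
    by_contra! h
    exact n2 (shrink W d q₂ q₁ hq.symm (by rwa [hd2]) (by rwa [hd2])).swap
  have hr : 0 ≤ r := hc1 ▸ dist_nonneg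
  have hs : 0 ≤ s := hd1 ▸ dist_nonneg
  have b1 : r ^ 2 < dist c p₂ ^ 2 := by gcongr
  have b2 : r ^ 2 < dist c q₂ ^ 2 := by gcongr
  have b3 : s ^ 2 < dist d p₁ ^ 2 := by gcongr
  have b4 : s ^ 2 < dist d q₁ ^ 2 := by gcongr
  obtain ⟨z, ⟨a, b, ha, hb, hab, rfl⟩, ⟨a', b', ha', hb', hab', hz⟩⟩ := hcross
  have k1 := aff c d p₁ q₁ a b hab
  have k2 := aff c d p₂ q₂ a' b' hab'
  rw [hz, k1, hc1, hc2, hd1, hd2] at k2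
  obtain rfl : b = 1 - a := by linarith
  obtain rfl : b' = 1 - a' := by linarith
  have m1 := mul_pos ha (sub_pos.2 b3)
  have m2 := mul_pos hb (sub_pos.2 b4)
  have m3 := mul_pos ha' (sub_pos.2 b1)
  have m4 := mul_pos hb' (sub_pos.2 b2)
  linarith
end

section
/- If a closed axis-aligned square R in the plane contains two points p and q, then there exists a closed axis-aligned square contained in R whose boundary passes through both p and q. Formally, in ℝ × ℝ with the sup distance: for all c, r ≥ 0 and p, q ∈ Metric.closedBall c r, there exist c' and r' ≥ 0 with Metric.closedBall c' r' ⊆ Metric.closedBall c r, p ∈ Metric.sphere c' r' and q ∈ Metric.sphere c' r'. -/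
theorem aux_line (a b c r s : ℝ) (ha : |a - c| ≤ r) (hb : |b - c| ≤ r) (hab : |a - b| ≤ 2 * s)
    (hs : s ≤ r) : ∃ y, |a - y| ≤ s ∧ |b - y| ≤ s ∧ |y - c| ≤ r - s := by
  rw [abs_le] at ha hb hab
  refine ⟨max (max a b - s) (c - r + s), ?_, ?_, ?_⟩ <;> rw [abs_le] <;>
  rcases max_cases a b with h | h <;>
  rcases max_cases (max a b - s) (c - r + s) with h' | h' <;>
  constructor <;> linarith

theorem aux_mid (a b c r : ℝ) (ha : |a - c| ≤ r) (hb : |b - c| ≤ r) :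
    |a - b| / 2 ≤ r ∧ |a - (a + b) / 2| = |a - b| / 2 ∧ |b - (a + b) / 2| = |a - b| / 2 ∧
      |(a + b) / 2 - c| ≤ r - |a - b| / 2 := by
  rw [abs_le] at ha hb
  have h1 : a - (a + b) / 2 = (a - b) / 2 := by ring
  have h2 : b - (a + b) / 2 = -((a - b) / 2) := by ring
  rw [h1, h2, abs_neg, abs_div, abs_two, abs_le]
  rcases abs_cases (a - b) with h | h <;>
  refine ⟨by linarith, rfl, rfl, by linarith, by linarith⟩

/-- If a closed axis-aligned square (a closed ball for the sup distance on `ℝ × ℝ`)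
contains two points `p` and `q`, then there exists a closed axis-aligned square
contained in it whose boundary passes through both `p` and `q`. -/
theorem shrunken_square (c : ℝ × ℝ) (r : ℝ) (hr : 0 ≤ r) (p q : ℝ × ℝ)
    (hp : p ∈ Metric.closedBall c r) (hq : q ∈ Metric.closedBall c r) :
    ∃ (c' : ℝ × ℝ) (r' : ℝ), 0 ≤ r' ∧
      Metric.closedBall c' r' ⊆ Metric.closedBall c r ∧
      p ∈ Metric.sphere c' r' ∧ q ∈ Metric.sphere c' r' := by
  obtain ⟨p1, p2⟩ := p
  obtain ⟨q1, q2⟩ := q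
  obtain ⟨c1, c2⟩ := c
  simp only [Metric.mem_closedBall, Prod.dist_eq, Real.dist_eq, max_le_iff] at hp hq
  obtain ⟨m1, m2, m3, m4⟩ := aux_mid p1 q1 c1 r hp.1 hq.1
  obtain ⟨n1, n2, n3, n4⟩ := aux_mid p2 q2 c2 r hp.2 hq.2
  rcases le_total |p2 - q2| |p1 - q1| with h | h
  · obtain ⟨y, y1, y2, y3⟩ := aux_line p2 q2 c2 r (|p1 - q1| / 2) hp.2 hq.2 (by linarith) m1
    refine ⟨((p1 + q1) / 2, y), |p1 - q1| / 2, by positivity,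
      Metric.closedBall_subset_closedBall' ?_, ?_, ?_⟩
    · rw [Prod.dist_eq, Real.dist_eq, Real.dist_eq]
      linarith [max_le m4 y3]
    · rw [Metric.mem_sphere, Prod.dist_eq, Real.dist_eq, Real.dist_eq]
      simp only [m2]
      exact max_eq_left y1
    · rw [Metric.mem_sphere, Prod.dist_eq, Real.dist_eq, Real.dist_eq]
      simp only [m3]
      exact max_eq_left y2
  · obtain ⟨y, y1, y2, y3⟩ := aux_line p1 q1 c1 r (|p2 - q2| / 2) hp.1 hq.1 (by linarith) n1
    refine ⟨(y, (p2 + q2) / 2), |p2 - q2| / 2, by positivity,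
      Metric.closedBall_subset_closedBall' ?_, ?_, ?_⟩
    · rw [Prod.dist_eq, Real.dist_eq, Real.dist_eq]
      linarith [max_le y3 n4]
    · rw [Metric.mem_sphere, Prod.dist_eq, Real.dist_eq, Real.dist_eq]
      simp only [n2]
      exact max_eq_right y1
    · rw [Metric.mem_sphere, Prod.dist_eq, Real.dist_eq, Real.dist_eq]
      simp only [n3]
      exact max_eq_right y2
end

section
/- Let p, q, w be points of ℝ × ℝ with pairwise distinct first coordinates and pairwise distinct second coordinates. If the first coordinate of w lies strictly between the first coordinates of p and q, or the second coordinate of w lies strictly between the second coordinates of p and q, then there exists an axis-aligned square with p and q on its boundary and w in its interior; formally there exist c ∈ ℝ × ℝ and r > 0 with dist∞(c,p) = dist∞(c,q) = r and dist∞(c,w) < r. -/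
def SqW (a b a' b' x y : ℝ) : Prop :=
  ∃ u v r : ℝ, 0 < r ∧ max |u - a| |v - b| = r ∧ max |u - a'| |v - b'| = r ∧ max |u - x| |v - y| < r

theorem SqW.swap {a b a' b' x y : ℝ} (h : SqW a b a' b' x y) : SqW a' b' a b x y := by
  obtain ⟨u, v, r, h0, h1, h2, h3⟩ := h
  exact ⟨u, v, r, h0, h2, h1, h3⟩

theorem SqW.coord {a b a' b' x y : ℝ} (h : SqW a b a' b' x y) : SqW b a b' a' y x := by
  obtain ⟨u, v, r, h0, h1, h2, h3⟩ := h
  refine ⟨v, u, r, h0, ?_, ?_, ?_⟩ <;> rw [max_comm] <;> assumption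

theorem SqW.neg {a b a' b' x y : ℝ} (h : SqW (-a) b (-a') b' (-x) y) : SqW a b a' b' x y := by
  obtain ⟨u, v, r, h0, h1, h2, h3⟩ := h
  have e : ∀ t : ℝ, |-u - t| = |u - -t| := fun t => by
    rw [← abs_neg]; congr 1; ring
  exact ⟨-u, v, r, h0, by rw [e]; exact h1, by rw [e]; exact h2, by rw [e]; exact h3⟩

theorem SqW.core {a b a' b' x y : ℝ} (h1 : a < x) (h2 : x < a') (h3 : b < b') (h4 : b < y) :
    SqW a b a' b' x y := by
  refine ⟨a' - ((a' - a) + (b' - b) + (y - b)), b + ((a' - a) + (b' - b) + (y - b)),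
    (a' - a) + (b' - b) + (y - b), by linarith, ?_, ?_, ?_⟩
  · rw [max_eq_right]
    · rw [abs_of_pos] <;> linarith
    · rw [abs_of_pos (a := b + _ - b) (by linarith), abs_le]
      constructor <;> linarith
  · rw [max_eq_left]
    · rw [abs_of_neg] <;> linarith
    · rw [abs_of_neg (a := _ - a') (by linarith), abs_le]
      constructor <;> linarith
  · rw [max_lt_iff, abs_lt, abs_lt]
    refine ⟨⟨?_, ?_⟩, ?_, ?_⟩ <;> linarith

theorem SqW.up {a b a' b' x y : ℝ} (h1 : a < x) (h2 : x < a') (h3 : b < b') :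
    SqW a b a' b' x y := by
  rcases lt_or_ge b y with h | h
  · exact SqW.core h1 h2 h3 h
  · apply SqW.neg
    apply SqW.coord
    apply SqW.neg
    apply SqW.coord
    apply SqW.swap
    apply SqW.core <;> linarith

theorem SqW.strip {a b a' b' x y : ℝ} (h1 : a < x) (h2 : x < a') (h3 : b ≠ b') :
    SqW a b a' b' x y := by
  rcases lt_or_gt_of_ne h3 with h | h
  · exact SqW.up h1 h2 h
  · apply SqW.coord
    apply SqW.neg
    apply SqW.coord
    apply SqW.up <;> linarith

theorem SqW.strip' {a b a' b' x y : ℝ} (h1 : min a a' < x) (h2 : x < max a a') (h3 : b ≠ b') :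
    SqW a b a' b' x y := by
  rcases le_total a a' with h | h
  · rw [min_eq_left h] at h1
    rw [max_eq_right h] at h2
    exact SqW.strip h1 h2 h3
  · rw [min_eq_right h] at h1
    rw [max_eq_left h] at h2
    exact (SqW.strip h1 h2 h3.symm).swap

/-- If a point `w` has its first coordinate strictly between the first
coordinates of `p` and `q`, or its second coordinate strictly between the
second coordinates of `p` and `q` (all three points having pairwise distinct
first and second coordinates), then there is an axis-aligned square with `p`
and `q` on its boundary and `w` in its interior.  The sup distance on
`ℝ × ℝ` is used: squares are its balls. -/
theorem square_strip_witness (p q w : ℝ × ℝ)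
    (hx : p.1 ≠ q.1 ∧ p.1 ≠ w.1 ∧ q.1 ≠ w.1)
    (hy : p.2 ≠ q.2 ∧ p.2 ≠ w.2 ∧ q.2 ≠ w.2)
    (hbetween : (min p.1 q.1 < w.1 ∧ w.1 < max p.1 q.1) ∨
      (min p.2 q.2 < w.2 ∧ w.2 < max p.2 q.2)) :
    ∃ (c : ℝ × ℝ) (r : ℝ), 0 < r ∧ dist c p = r ∧ dist c q = r ∧ dist c w < r := by
  have key : SqW p.1 p.2 q.1 q.2 w.1 w.2 := by
    rcases hbetween with h | h
    · exact SqW.strip' h.1 h.2 hy.1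
    · exact (SqW.strip' h.1 h.2 hx.1).coord
  obtain ⟨u, v, r, h0, h1, h2, h3⟩ := key
  exact ⟨(u, v), r, h0, by simpa [Prod.dist_eq, Real.dist_eq] using h1,
    by simpa [Prod.dist_eq, Real.dist_eq] using h2,
    by simpa [Prod.dist_eq, Real.dist_eq] using h3⟩
end

section
/- Every square graph is a permutation graph, realizable with a single witness: let P and W be finite sets in ℝ × ℝ such that all points of P ∪ W have pairwise distinct first coordinates and pairwise distinct second coordinates. Then there exists an injective map f : P → ℝ × ℝ such that for all distinct p, q ∈ P, p and q are adjacent in the square graph SG⁺(P,W) if and only if ((f p).1 − (f q).1) · ((f p).2 − (f q).2) < 0, i.e., if and only if f p and f q are incomparable in the coordinatewise dominance order on ℝ². -/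
/-- adjacency in the square graph -/
def SqAdj (W : Finset (ℝ × ℝ)) (p q : ℝ × ℝ) : Prop :=
  ∃ (c : ℝ × ℝ) (r : ℝ), dist c p = r ∧ dist c q = r ∧ ∃ w ∈ W, dist c w < r

/-- strict dominance -/
def Dom (p q : ℝ × ℝ) : Prop := p.1 < q.1 ∧ p.2 < q.2

def GenPos (p q : ℝ × ℝ) : Prop := p ≠ q → p.1 ≠ q.1 ∧ p.2 ≠ q.2

def Typ1 (W : Finset (ℝ × ℝ)) (p : ℝ × ℝ) : Prop := ∀ w ∈ W, w ≠ p → Dom w p ∨ Dom p w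

def rfl2 (p : ℝ × ℝ) : ℝ × ℝ := (p.1, -p.2)

def Rlz (W S : Finset (ℝ × ℝ)) : Prop :=
  ∃ f g : ℝ × ℝ → ℝ, ∀ p ∈ S, ∀ q ∈ S, p ≠ q →
    (SqAdj W p q → (f p - f q) * (g p - g q) < 0) ∧
    (¬ SqAdj W p q → 0 < (f p - f q) * (g p - g q))

lemma SqAdj.symm' {W : Finset (ℝ × ℝ)} {p q : ℝ × ℝ} (h : SqAdj W p q) : SqAdj W q p := by
  obtain ⟨c, r, h1, h2, h3⟩ := h
  exact ⟨c, r, h2, h1, h3⟩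

lemma rfl2_rfl2 (p : ℝ × ℝ) : rfl2 (rfl2 p) = p := by simp [rfl2]

lemma dist_rfl2 (p q : ℝ × ℝ) : dist (rfl2 p) (rfl2 q) = dist p q := by
  simp [rfl2, Prod.dist_eq]

lemma sqAdj_rfl2_of {W : Finset (ℝ × ℝ)} {p q : ℝ × ℝ} (h : SqAdj W p q) :
    SqAdj (W.image rfl2) (rfl2 p) (rfl2 q) := by
  obtain ⟨c, r, h1, h2, w, hw, h3⟩ := h
  refine ⟨rfl2 c, r, by rw [dist_rfl2, h1], by rw [dist_rfl2, h2], rfl2 w,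
    Finset.mem_image_of_mem _ hw, by rw [dist_rfl2]; exact h3⟩

lemma image_rfl2 (W : Finset (ℝ × ℝ)) : (W.image rfl2).image rfl2 = W := by
  rw [Finset.image_image]
  have : rfl2 ∘ rfl2 = id := funext rfl2_rfl2
  rw [this, Finset.image_id]

lemma sqAdj_rfl2 {W : Finset (ℝ × ℝ)} {p q : ℝ × ℝ} :
    SqAdj (W.image rfl2) (rfl2 p) (rfl2 q) ↔ SqAdj W p q := by
  refine ⟨fun h => ?_, sqAdj_rfl2_of⟩
  have := sqAdj_rfl2_of h
  rwa [image_rfl2, rfl2_rfl2, rfl2_rfl2] at this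

lemma sqAdj_of_quad {W : Finset (ℝ × ℝ)} {p q w : ℝ × ℝ} (h : Dom p q) (hw : w ∈ W)
    (h1 : p.1 < w.1) (h2 : w.2 < q.2) : SqAdj W p q := by
  obtain ⟨ha, hb⟩ := h
  obtain ⟨s, hs⟩ : ∃ s, s = (q.1 - p.1) + (q.2 - p.2) + (w.1 - p.1) + (q.2 - w.2) := ⟨_, rfl⟩
  refine ⟨(p.1 + s / 2, q.2 - s / 2), s / 2, ?_, ?_, w, hw, ?_⟩
  · rw [Prod.dist_eq, Real.dist_eq, Real.dist_eq]
    apply le_antisymm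
    · apply max_le <;> rw [abs_le] <;> constructor <;> dsimp only <;> linarith
    · apply le_max_of_le_left
      apply le_trans _ (le_abs_self _)
      dsimp only; linarith
  · rw [Prod.dist_eq, Real.dist_eq, Real.dist_eq]
    apply le_antisymm
    · apply max_le <;> rw [abs_le] <;> constructor <;> dsimp only <;> linarith
    · apply le_max_of_le_right
      apply le_trans _ (neg_le_abs _)
      dsimp only; linarith
  · rw [Prod.dist_eq, Real.dist_eq, Real.dist_eq]
    apply max_lt <;> rw [abs_lt] <;> constructor <;> dsimp only <;> linarith

lemma sqAdj_of_quad' {W : Finset (ℝ × ℝ)} {p q w : ℝ × ℝ} (h : Dom p q) (hw : w ∈ W)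
    (h1 : w.1 < q.1) (h2 : p.2 < w.2) : SqAdj W p q := by
  obtain ⟨ha, hb⟩ := h
  obtain ⟨s, hs⟩ : ∃ s, s = (q.1 - p.1) + (q.2 - p.2) + (q.1 - w.1) + (w.2 - p.2) := ⟨_, rfl⟩
  refine ⟨(q.1 - s / 2, p.2 + s / 2), s / 2, ?_, ?_, w, hw, ?_⟩
  · rw [Prod.dist_eq, Real.dist_eq, Real.dist_eq]
    apply le_antisymm
    · apply max_le <;> rw [abs_le] <;> constructor <;> dsimp only <;> linarith
    · apply le_max_of_le_right
      apply le_trans _ (le_abs_self _)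
      dsimp only; linarith
  · rw [Prod.dist_eq, Real.dist_eq, Real.dist_eq]
    apply le_antisymm
    · apply max_le <;> rw [abs_le] <;> constructor <;> dsimp only <;> linarith
    · apply le_max_of_le_left
      apply le_trans _ (neg_le_abs _)
      dsimp only; linarith
  · rw [Prod.dist_eq, Real.dist_eq, Real.dist_eq]
    apply max_lt <;> rw [abs_lt] <;> constructor <;> dsimp only <;> linarith

lemma not_sqAdj_iff {W : Finset (ℝ × ℝ)} {p q : ℝ × ℝ} (h : Dom p q) :
    ¬ SqAdj W p q ↔ ∀ w ∈ W, (w.1 ≤ p.1 ∧ w.2 ≤ p.2) ∨ (q.1 ≤ w.1 ∧ q.2 ≤ w.2) := by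
  constructor
  · intro hn w hw
    by_contra hc
    have hd := h
    obtain ⟨ha, hb⟩ := h
    have h1 : ¬ (p.1 < w.1 ∧ w.2 < q.2) := fun h => hn (sqAdj_of_quad hd hw h.1 h.2)
    have h2 : ¬ (w.1 < q.1 ∧ p.2 < w.2) := fun h => hn (sqAdj_of_quad' hd hw h.1 h.2)
    grind
  · rintro hall ⟨c, r, hp, hq, w, hw, hlt⟩
    obtain ⟨ha, hb⟩ := h
    rw [Prod.dist_eq, Real.dist_eq, Real.dist_eq] at hp hq hlt
    obtain ⟨l1, l2⟩ := max_lt_iff.1 hlt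
    obtain ⟨p1, p2⟩ := max_le_iff.1 hp.le
    obtain ⟨q1, q2⟩ := max_le_iff.1 hq.le
    rw [abs_lt] at l1 l2
    rw [abs_le] at p1 p2 q1 q2
    rcases hall w hw with ⟨w1, w2⟩ | ⟨w1, w2⟩
    · refine hp.not_lt ?_
      apply max_lt <;> rw [abs_lt] <;> constructor <;> linarith
    · refine hq.not_lt ?_
      apply max_lt <;> rw [abs_lt] <;> constructor <;> linarith

lemma rlz_union {W S T : Finset (ℝ × ℝ)} (hS : Rlz W S) (hT : Rlz W T)
    (hST : ∀ p ∈ S, ∀ q ∈ T, q ∉ S → SqAdj W p q) : Rlz W (S ∪ T) := by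
  classical
  obtain ⟨f, g, h⟩ := hS
  obtain ⟨f', g', h'⟩ := hT
  obtain ⟨M, hM⟩ := Finset.exists_le
    ((S ∪ T).image fun p => |f p| + |g p| + |f' p| + |g' p|)
  have hb : ∀ p ∈ S ∪ T, |f p| + |g p| + |f' p| + |g' p| ≤ M :=
    fun p hp => hM _ (Finset.mem_image_of_mem _ hp)
  have key : ∀ p ∈ S, ∀ q ∈ T, f p - (f' q + (2 * M + 1)) < 0 ∧ 0 < g p - (g' q - (2 * M + 1)) := by
    intro p hp q hq
    have h1 := hb p (Finset.mem_union_left _ hp)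
    have h2 := hb q (Finset.mem_union_right _ hq)
    have := abs_nonneg (f p)
    have := abs_nonneg (g p)
    have := abs_nonneg (f' p)
    have := abs_nonneg (g' p)
    have := abs_nonneg (f q)
    have := abs_nonneg (g q)
    have := abs_nonneg (f' q)
    have := abs_nonneg (g' q)
    have := le_abs_self (f p)
    have := neg_le_abs (g p)
    have := neg_le_abs (f' q)
    have := le_abs_self (g' q)
    constructor <;> linarith
  refine ⟨fun p => if p ∈ S then f p else f' p + (2 * M + 1),
    fun p => if p ∈ S then g p else g' p - (2 * M + 1), ?_⟩
  intro p hp q hq hpq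
  have hp' : p ∉ S → p ∈ T := fun h => (Finset.mem_union.1 hp).resolve_left h
  have hq' : q ∉ S → q ∈ T := fun h => (Finset.mem_union.1 hq).resolve_left h
  by_cases h1 : p ∈ S <;> by_cases h2 : q ∈ S <;> simp only [h1, h2, if_true, if_false]
  · exact h p h1 q h2 hpq
  · refine ⟨fun _ => ?_, fun hn => (hn (hST p h1 q (hq' h2) h2)).elim⟩
    obtain ⟨k1, k2⟩ := key p h1 q (hq' h2)
    exact mul_neg_of_neg_of_pos k1 k2
  · refine ⟨fun _ => ?_, fun hn => (hn (hST q h2 p (hp' h1) h1).symm').elim⟩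
    obtain ⟨k1, k2⟩ := key q h2 p (hp' h1)
    nlinarith
  · have := h' p (hp' h1) q (hq' h2) hpq
    convert this using 3 <;> ring

lemma rlz_insert {W S : Finset (ℝ × ℝ)} (a : ℝ × ℝ) (hS : Rlz W S)
    (ha : ∀ p ∈ S, ¬ SqAdj W a p) : Rlz W (insert a S) := by
  classical
  obtain ⟨f, g, h⟩ := hS
  obtain ⟨M, hM⟩ := Finset.exists_le (S.image fun p => |f p| + |g p|)
  have hb : ∀ p ∈ S, |f p| + |g p| ≤ M :=
    fun p hp => hM _ (Finset.mem_image_of_mem _ hp)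
  have key : ∀ p ∈ S, -(M + 1) - f p < 0 ∧ -(M + 1) - g p < 0 := by
    intro p hp
    have h1 := hb p hp
    have := abs_nonneg (f p)
    have := abs_nonneg (g p)
    have := neg_le_abs (f p)
    have := neg_le_abs (g p)
    constructor <;> linarith
  refine ⟨fun p => if p = a then -(M + 1) else f p,
    fun p => if p = a then -(M + 1) else g p, ?_⟩
  intro p hp q hq hpq
  have hp' : p ≠ a → p ∈ S := fun h => (Finset.mem_insert.1 hp).resolve_left h
  have hq' : q ≠ a → q ∈ S := fun h => (Finset.mem_insert.1 hq).resolve_left h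
  by_cases h1 : p = a <;> by_cases h2 : q = a <;> simp only [h1, h2, if_true, if_false]
  · exact (hpq (h1.trans h2.symm)).elim
  · refine ⟨fun hn => (ha q (hq' h2) hn).elim, fun hn => ?_⟩
    obtain ⟨k1, k2⟩ := key q (hq' h2)
    exact mul_pos_of_neg_of_neg k1 k2
  · refine ⟨fun hn => (ha p (hp' h1) hn.symm').elim, fun hn => ?_⟩
    obtain ⟨k1, k2⟩ := key p (hp' h1)
    nlinarith
  · exact h p (hp' h1) q (hq' h2) hpq

noncomputable def sg (x : ℝ) : ℝ := Real.arctan x / 8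

lemma sg_lt {x y : ℝ} (h : x < y) : sg x < sg y := by
  have := Real.arctan_strictMono h
  unfold sg; linarith

lemma sg_ub (x : ℝ) : sg x < 1 / 4 := by
  have := Real.arctan_lt_pi_div_two x
  have := Real.pi_lt_four
  unfold sg; linarith

lemma sg_lb (x : ℝ) : -(1 / 4) < sg x := by
  have := Real.neg_pi_div_two_lt_arctan x
  have := Real.pi_lt_four
  unfold sg; linarith

open Classical in
noncomputable def lo (W : Finset (ℝ × ℝ)) (p : ℝ × ℝ) : Finset (ℝ × ℝ) := W.filter (fun w => Dom w p)

open Classical in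
noncomputable def fX (W : Finset (ℝ × ℝ)) (p : ℝ × ℝ) : ℝ :=
  if p ∈ W then
    if Even (lo W p).card then ((lo W p).card : ℝ) + 4 / 3 else ((lo W p).card : ℝ) - 1 / 3
  else ((lo W p).card : ℝ) + sg p.1

open Classical in
noncomputable def fY (W : Finset (ℝ × ℝ)) (p : ℝ × ℝ) : ℝ :=
  if p ∈ W then
    if Even (lo W p).card then -((lo W p).card : ℝ) + 1 / 3 else -((lo W p).card : ℝ) - 4 / 3
  else -((lo W p).card : ℝ) + sg p.2

lemma cast_cases {a b : ℕ} (h : a ≤ b) : a = b ∨ a + 1 = b ∨ ((a : ℝ) + 2 = b) ∨ ((a : ℝ) + 3 ≤ b) := by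
  have : a = b ∨ a + 1 = b ∨ a + 2 = b ∨ a + 3 ≤ b := by omega
  rcases this with h | h | h | h
  · exact Or.inl h
  · exact Or.inr (Or.inl h)
  · exact Or.inr (Or.inr (Or.inl (by exact_mod_cast h)))
  · exact Or.inr (Or.inr (Or.inr (by exact_mod_cast h)))

open Classical in
lemma chain_dom {W : Finset (ℝ × ℝ)} {p q : ℝ × ℝ} (h : Dom p q)
    (hle : (lo W p).card + (if p ∈ W then 1 else 0) ≤ (lo W q).card) :
    ((lo W p).card + (if p ∈ W then 1 else 0) = (lo W q).card →
      0 < (fX W p - fX W q) * (fY W p - fY W q)) ∧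
    ((lo W p).card + (if p ∈ W then 1 else 0) ≠ (lo W q).card →
      (fX W p - fX W q) * (fY W p - fY W q) < 0) := by
  have s1 := sg_lt h.1
  have s2 := sg_lt h.2
  have u1 := sg_ub p.1
  have u2 := sg_ub p.2
  have u3 := sg_ub q.1
  have u4 := sg_ub q.2
  have l1 := sg_lb p.1
  have l2 := sg_lb p.2
  have l3 := sg_lb q.1
  have l4 := sg_lb q.2
  unfold fX fY
  generalize (lo W p).card = a at *
  generalize (lo W q).card = b at *
  by_cases hp : p ∈ W
  · simp only [hp, if_true] at hle ⊢
    constructor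
    · intro e
      subst e
      push_cast
      by_cases hq : q ∈ W <;> by_cases ea : Even a <;> simp only [hq, ea, Nat.even_add_one, if_true, if_false, not_true, not_false_eq_true]
      · apply mul_pos <;> linarith
      · apply mul_pos_of_neg_of_neg <;> linarith
      · apply mul_pos <;> linarith
      · apply mul_pos_of_neg_of_neg <;> linarith
    · intro e
      have h2 : a + 2 ≤ b := by omega
      rcases h2.eq_or_lt with e2 | e2
      · subst e2
        push_cast
        by_cases hq : q ∈ W <;> by_cases ea : Even a <;> simp only [hq, ea, Nat.even_add, if_true, if_false, even_two, iff_true] <;> apply mul_neg_of_neg_of_pos <;> linarith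
      · have h3 : (a : ℝ) + 3 ≤ b := by exact_mod_cast e2
        by_cases hq : q ∈ W <;> by_cases ea : Even a <;> by_cases eb : Even b <;> simp only [hq, ea, eb, if_true, if_false] <;> apply mul_neg_of_neg_of_pos <;> linarith
  · simp only [hp, if_false, add_zero] at hle ⊢
    constructor
    · intro e
      subst e
      by_cases hq : q ∈ W <;> by_cases ea : Even a <;> simp only [hq, ea, if_true, if_false]
      · apply mul_pos_of_neg_of_neg <;> linarith
      · apply mul_pos <;> linarith
      · apply mul_pos_of_neg_of_neg <;> linarith
      · apply mul_pos_of_neg_of_neg <;> linarith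
    · intro e
      have h2 : a + 1 ≤ b := by omega
      have h3 : (a : ℝ) + 1 ≤ b := by exact_mod_cast h2
      by_cases hq : q ∈ W <;> by_cases eb : Even b <;> simp only [hq, eb, if_true, if_false] <;> apply mul_neg_of_neg_of_pos <;> linarith

open Classical in
lemma chain_dom' {W : Finset (ℝ × ℝ)} {p q : ℝ × ℝ} (h : Dom p q)
    (hp : Typ1 W p) (hq : Typ1 W q) :
    (SqAdj W p q → (fX W p - fX W q) * (fY W p - fY W q) < 0) ∧
    (¬ SqAdj W p q → 0 < (fX W p - fX W q) * (fY W p - fY W q)) := by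
  have hsub : W.filter (fun w => w.1 ≤ p.1 ∧ w.2 ≤ p.2) ⊆ lo W q := by
    intro w hw
    obtain ⟨h1, h2, h3⟩ := Finset.mem_filter.1 hw
    exact Finset.mem_filter.2 ⟨h1, h2.trans_lt h.1, h3.trans_lt h.2⟩
  have hcard : (W.filter (fun w => w.1 ≤ p.1 ∧ w.2 ≤ p.2)).card
      = (lo W p).card + (if p ∈ W then 1 else 0) := by
    by_cases hpW : p ∈ W
    · have : W.filter (fun w => w.1 ≤ p.1 ∧ w.2 ≤ p.2) = insert p (lo W p) := by
        ext w
        simp only [Finset.mem_filter, Finset.mem_insert, lo]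
        constructor
        · rintro ⟨h1, h2, h3⟩
          by_cases e : w = p
          · exact Or.inl e
          · rcases hp w h1 e with d | d
            · exact Or.inr ⟨h1, d⟩
            · exact absurd d.1 (not_lt.2 h2)
        · rintro (e | ⟨h1, h2⟩)
          · subst e; exact ⟨hpW, le_rfl, le_rfl⟩
          · exact ⟨h1, h2.1.le, h2.2.le⟩
      rw [this, Finset.card_insert_of_notMem, if_pos hpW]
      intro hh
      exact lt_irrefl _ (Finset.mem_filter.1 hh).2.1
    · rw [if_neg hpW, add_zero]
      congr 1
      apply Finset.filter_congr
      intro w hw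
      have e : w ≠ p := fun e => hpW (e ▸ hw)
      constructor
      · rintro ⟨h2, h3⟩
        rcases hp w hw e with d | d
        · exact d
        · exact absurd d.1 (not_lt.2 h2)
      · intro d
        exact ⟨d.1.le, d.2.le⟩
  have hle := Finset.card_le_card hsub
  rw [hcard] at hle
  have key : ¬ SqAdj W p q ↔ (lo W p).card + (if p ∈ W then 1 else 0) = (lo W q).card := by
    rw [not_sqAdj_iff h, ← hcard]
    constructor
    · intro hall
      congr 1
      apply Finset.Subset.antisymm hsub
      intro w hw
      obtain ⟨h1, h2⟩ := Finset.mem_filter.1 hw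
      refine Finset.mem_filter.2 ⟨h1, (hall w h1).resolve_right fun h3 => ?_⟩
      exact absurd h2.1 (not_lt.2 h3.1)
    · intro e w hw
      have e2 := Finset.eq_of_subset_of_card_le hsub e.ge
      by_cases hwq : w = q
      · subst hwq; exact Or.inr ⟨le_rfl, le_rfl⟩
      · rcases hq w hw hwq with d | d
        · left
          have : w ∈ lo W q := Finset.mem_filter.2 ⟨hw, d⟩
          rw [← e2] at this
          exact (Finset.mem_filter.1 this).2
        · exact Or.inr ⟨d.1.le, d.2.le⟩
  obtain ⟨c1, c2⟩ := chain_dom h hle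
  refine ⟨fun ha => c2 fun e => key.2 e ha, fun hn => c1 (key.1 hn)⟩

lemma chain_inc {W : Finset (ℝ × ℝ)} {p q : ℝ × ℝ} (h1 : p.1 < q.1) (h2 : q.2 < p.2)
    (hp : Typ1 W p) (hq : Typ1 W q) (hne : ∃ w ∈ W, w ≠ p) :
    SqAdj W p q ∧ (fX W p - fX W q) * (fY W p - fY W q) < 0 := by
  have hpq : p ≠ q := fun e => by subst e; exact lt_irrefl _ h1
  have hpW : p ∉ W := fun h => by
    rcases hq p h hpq with d | d
    · exact absurd d.2 (not_lt.2 h2.le)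
    · exact absurd d.1 (not_lt.2 h1.le)
  have hqW : q ∉ W := fun h => by
    rcases hp q h hpq.symm with d | d
    · exact absurd d.1 (not_lt.2 h1.le)
    · exact absurd d.2 (not_lt.2 h2.le)
  have hlo : lo W p = lo W q := by
    classical
    unfold lo
    apply Finset.filter_congr
    intro w hw
    have a1 := hp w hw (fun e => hpW (e ▸ hw))
    have a2 := hq w hw (fun e => hqW (e ▸ hw))
    unfold Dom at *
    grind
  constructor
  · by_contra hn
    have hd : Dom (rfl2 p) (rfl2 q) := ⟨h1, by simpa [rfl2] using h2⟩
    rw [← sqAdj_rfl2, not_sqAdj_iff hd] at hn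
    obtain ⟨w, hw, hwp⟩ := hne
    have a1 := hp w hw (fun e => hpW (e ▸ hw))
    have a2 := hq w hw (fun e => hqW (e ▸ hw))
    have a3 := hn (rfl2 w) (Finset.mem_image_of_mem _ hw)
    simp only [rfl2] at a3
    unfold Dom at *
    grind
  · unfold fX fY
    rw [if_neg hpW, if_neg hqW, if_neg hpW, if_neg hqW, hlo]
    have := sg_lt h1
    have := sg_lt h2
    apply mul_neg_of_neg_of_pos <;> linarith

lemma rlz_typ1 {W S : Finset (ℝ × ℝ)} (hS : ∀ p ∈ S, ∀ q ∈ S, GenPos p q)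
    (ht : ∀ p ∈ S, Typ1 W p) (hne : ∀ p ∈ S, ∃ w ∈ W, w ≠ p) : Rlz W S := by
  refine ⟨fX W, fY W, ?_⟩
  have main : ∀ p ∈ S, ∀ q ∈ S, p.1 < q.1 →
    (SqAdj W p q → (fX W p - fX W q) * (fY W p - fY W q) < 0) ∧
    (¬ SqAdj W p q → 0 < (fX W p - fX W q) * (fY W p - fY W q)) := by
    intro p hp q hq h1
    rcases lt_or_gt_of_ne (hS p hp q hq (fun e => by subst e; exact lt_irrefl _ h1)).2 with h2 | h2
    · exact chain_dom' ⟨h1, h2⟩ (ht p hp) (ht q hq)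
    · obtain ⟨a, b⟩ := chain_inc h1 h2 (ht p hp) (ht q hq) (hne p hp)
      exact ⟨fun _ => b, fun hn => (hn a).elim⟩
  intro p hp q hq hpq
  rcases lt_or_gt_of_ne (hS p hp q hq hpq).1 with h1 | h1
  · exact main p hp q hq h1
  · obtain ⟨a, b⟩ := main q hq p hp h1
    have e : (fX W p - fX W q) * (fY W p - fY W q) = (fX W q - fX W p) * (fY W q - fY W p) := by ring
    rw [e]
    exact ⟨fun h => a h.symm', fun h => b fun h' => h h'.symm'⟩

lemma rlz_typ2 {W S : Finset (ℝ × ℝ)} (hS : ∀ p ∈ S, ∀ q ∈ S, GenPos p q)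
    (ht : ∀ p ∈ S, Typ1 (W.image rfl2) (rfl2 p)) (hne : ∀ p ∈ S, ∃ w ∈ W, w ≠ p) : Rlz W S := by
  have inj : ∀ a b, rfl2 a = rfl2 b → a = b := fun a b h => by
    rw [← rfl2_rfl2 a, h, rfl2_rfl2]
  have : Rlz (W.image rfl2) (S.image rfl2) := by
    apply rlz_typ1
    · intro p hp q hq
      obtain ⟨p, hp', rfl⟩ := Finset.mem_image.1 hp
      obtain ⟨q, hq', rfl⟩ := Finset.mem_image.1 hq
      intro hpq
      have := hS p hp' q hq' (fun e => hpq (e ▸ rfl))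
      simpa [rfl2] using this
    · intro p hp
      obtain ⟨p, hp', rfl⟩ := Finset.mem_image.1 hp
      exact ht p hp'
    · intro p hp
      obtain ⟨p, hp', rfl⟩ := Finset.mem_image.1 hp
      obtain ⟨w, hw, h⟩ := hne p hp'
      exact ⟨rfl2 w, Finset.mem_image_of_mem _ hw, fun e => h (inj _ _ e)⟩
  obtain ⟨f, g, h⟩ := this
  refine ⟨fun p => f (rfl2 p), fun p => g (rfl2 p), ?_⟩
  intro p hp q hq hpq
  have := h (rfl2 p) (Finset.mem_image_of_mem _ hp) (rfl2 q) (Finset.mem_image_of_mem _ hq)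
    (fun e => hpq (inj _ _ e))
  rwa [sqAdj_rfl2] at this

lemma typ_of_dom {W : Finset (ℝ × ℝ)} {p q : ℝ × ℝ} (h : Dom p q)
    (hp : ∀ w ∈ W, GenPos w p) (hq : ∀ w ∈ W, GenPos w q) (hn : ¬ SqAdj W p q) :
    Typ1 W p ∧ Typ1 W q := by
  rw [not_sqAdj_iff h] at hn
  obtain ⟨h1, h2⟩ := h
  constructor
  · intro w hw e
    obtain ⟨e1, e2⟩ := hp w hw e
    rcases hn w hw with ⟨a, b⟩ | ⟨a, b⟩
    · exact Or.inl ⟨lt_of_le_of_ne a e1, lt_of_le_of_ne b e2⟩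
    · exact Or.inr ⟨by linarith, by linarith⟩
  · intro w hw e
    obtain ⟨e1, e2⟩ := hq w hw e
    rcases hn w hw with ⟨a, b⟩ | ⟨a, b⟩
    · exact Or.inl ⟨by linarith, by linarith⟩
    · exact Or.inr ⟨lt_of_le_of_ne a e1.symm, lt_of_le_of_ne b e2.symm⟩

lemma genPos_rfl2 {p q : ℝ × ℝ} (h : GenPos p q) : GenPos (rfl2 p) (rfl2 q) := by
  intro hpq
  have := h (fun e => hpq (e ▸ rfl))
  simpa [rfl2] using this

lemma typ_of_not_adj {W : Finset (ℝ × ℝ)} {p q : ℝ × ℝ} (hpq : p ≠ q) (h : GenPos p q)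
    (hp : ∀ w ∈ W, GenPos w p) (hq : ∀ w ∈ W, GenPos w q) (hn : ¬ SqAdj W p q) :
    (Typ1 W p ∧ Typ1 W q) ∨ (Typ1 (W.image rfl2) (rfl2 p) ∧ Typ1 (W.image rfl2) (rfl2 q)) := by
  have hn' : ¬ SqAdj W q p := fun h => hn h.symm'
  have hr : ∀ x, (∀ w ∈ W, GenPos w x) → ∀ w ∈ W.image rfl2, GenPos w (rfl2 x) := by
    intro x hx w hw
    obtain ⟨w, hw', rfl⟩ := Finset.mem_image.1 hw
    exact genPos_rfl2 (hx w hw')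
  obtain ⟨g1, g2⟩ := h hpq
  rcases lt_or_gt_of_ne g1 with h1 | h1 <;> rcases lt_or_gt_of_ne g2 with h2 | h2
  · exact Or.inl (typ_of_dom ⟨h1, h2⟩ hp hq hn)
  · rw [← sqAdj_rfl2] at hn
    exact Or.inr (typ_of_dom ⟨h1, by simpa [rfl2] using h2⟩ (hr p hp) (hr q hq) hn)
  · rw [← sqAdj_rfl2] at hn'
    have hd : Dom (rfl2 q) (rfl2 p) := ⟨h1, by simpa [rfl2] using h2⟩
    exact Or.inr (typ_of_dom hd (hr q hq) (hr p hp) hn').symm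
  · exact Or.inl (typ_of_dom ⟨h1, h2⟩ hq hp hn').symm

lemma typ_excl {W : Finset (ℝ × ℝ)} {p : ℝ × ℝ} (hne : ∃ w ∈ W, w ≠ p) (h1 : Typ1 W p)
    (h2 : Typ1 (W.image rfl2) (rfl2 p)) : False := by
  obtain ⟨w, hw, e⟩ := hne
  have a := h1 w hw e
  have b := h2 (rfl2 w) (Finset.mem_image_of_mem _ hw)
    (fun e' => e (by rw [← rfl2_rfl2 w, e', rfl2_rfl2]))
  simp only [Dom, rfl2] at a b
  grind

lemma rlz_main {W P : Finset (ℝ × ℝ)} (hS : ∀ p ∈ P, ∀ q ∈ P, GenPos p q)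
    (hW : ∀ p ∈ P, ∀ w ∈ W, GenPos w p) (hne : ∀ p ∈ P, ∃ w ∈ W, w ≠ p) : Rlz W P := by
  classical
  have r1 : Rlz W (P.filter fun p => Typ1 W p) := by
    apply rlz_typ1 <;> simp only [Finset.mem_filter]
    · intro p hp q hq
      exact hS p hp.1 q hq.1
    · intro p hp
      exact hp.2
    · intro p hp
      exact hne p hp.1
  have r2 : Rlz W (P.filter fun p => Typ1 (W.image rfl2) (rfl2 p)) := by
    apply rlz_typ2 <;> simp only [Finset.mem_filter]
    · intro p hp q hq
      exact hS p hp.1 q hq.1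
    · intro p hp
      exact hp.2
    · intro p hp
      exact hne p hp.1
  have r0 : Rlz W (P.filter fun p => ¬ Typ1 W p ∧ ¬ Typ1 (W.image rfl2) (rfl2 p)) := by
    refine ⟨fun p => p.1, fun p => - p.1, ?_⟩
    intro p hp q hq hpq
    obtain ⟨hp, p1, p2⟩ := Finset.mem_filter.1 hp
    obtain ⟨hq, q1, q2⟩ := Finset.mem_filter.1 hq
    constructor
    · intro _
      have : p.1 - q.1 ≠ 0 := sub_ne_zero.2 (hS p hp q hq hpq).1
      have := sq_pos_of_ne_zero this
      nlinarith
    · intro hn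
      rcases typ_of_not_adj hpq (hS p hp q hq) (hW p hp) (hW q hq) hn with h | h
      · exact (p1 h.1).elim
      · exact (p2 h.1).elim
  have r12 := rlz_union r1 r2 (by
    intro p hp q hq hq'
    obtain ⟨hp, p1⟩ := Finset.mem_filter.1 hp
    obtain ⟨hq, q1⟩ := Finset.mem_filter.1 hq
    by_contra hn
    have hpq : p ≠ q := fun e => hq' (e ▸ Finset.mem_filter.2 ⟨hp, p1⟩)
    rcases typ_of_not_adj hpq (hS p hp q hq) (hW p hp) (hW q hq) hn with h | h
    · exact typ_excl (hne q hq) h.2 q1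
    · exact typ_excl (hne p hp) p1 h.1)
  have r := rlz_union r12 r0 (by
    intro p hp q hq hq'
    obtain ⟨hq, q1, q2⟩ := Finset.mem_filter.1 hq
    have hpP : p ∈ P := by
      rcases Finset.mem_union.1 hp with h | h <;> exact (Finset.mem_filter.1 h).1
    by_contra hn
    have hpq : p ≠ q := fun e => hq' (e ▸ hp)
    rcases typ_of_not_adj hpq (hS p hpP q hq) (hW p hpP) (hW q hq) hn with h | h
    · exact q1 h.2
    · exact q2 h.2)
  convert r using 1
  ext p
  simp only [Finset.mem_union, Finset.mem_filter]
  tauto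

lemma rlz_all {W P : Finset (ℝ × ℝ)} (hS : ∀ p ∈ P, ∀ q ∈ P, GenPos p q)
    (hW : ∀ p ∈ P, ∀ w ∈ W, GenPos w p) : Rlz W P := by
  classical
  rcases W.eq_empty_or_nonempty with e | ⟨w, hw⟩
  · subst e
    refine ⟨fun p => p.1, fun p => p.1, ?_⟩
    intro p hp q hq hpq
    constructor
    · rintro ⟨c, r, _, _, w, hw, _⟩
      simp at hw
    · intro _
      have : p.1 - q.1 ≠ 0 := sub_ne_zero.2 (hS p hp q hq hpq).1
      have := sq_pos_of_ne_zero this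
      nlinarith
  by_cases hne : ∀ p ∈ P, ∃ w ∈ W, w ≠ p
  · exact rlz_main hS hW hne
  push Not at hne
  obtain ⟨a, ha, haW⟩ := hne
  have h1 : Rlz W (P.erase a) := by
    apply rlz_main
    · intro p hp q hq
      exact hS p (Finset.mem_of_mem_erase hp) q (Finset.mem_of_mem_erase hq)
    · intro p hp
      exact hW p (Finset.mem_of_mem_erase hp)
    · intro p hp
      refine ⟨w, hw, ?_⟩
      rw [haW w hw]
      exact (Finset.ne_of_mem_erase hp).symm
  have h2 := rlz_insert a h1 (by
    rintro p hp ⟨c, r, h1, h2, w, hw, h3⟩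
    rw [haW w hw] at h3
    exact absurd h1 h3.ne)
  rwa [Finset.insert_erase ha] at h2


/-- Every square graph is a permutation graph: there is an injective placement
`f` of the vertex set `P` in the plane such that two distinct points of `P`
are adjacent in the square graph `SG⁺(P, W)` (some axis-aligned square has
both on its boundary and a witness of `W` in its interior, for the sup
distance on `ℝ × ℝ`) if and only if their images under `f` are incomparable
in the coordinatewise dominance order. -/
theorem squareGraph_is_permutationGraph (P W : Finset (ℝ × ℝ))
    (hcoord : ∀ a ∈ P ∪ W, ∀ b ∈ P ∪ W, a ≠ b → a.1 ≠ b.1 ∧ a.2 ≠ b.2) :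
    ∃ f : ℝ × ℝ → ℝ × ℝ, Set.InjOn f ↑P ∧
      ∀ p ∈ P, ∀ q ∈ P, p ≠ q →
        ((∃ (c : ℝ × ℝ) (r : ℝ), dist c p = r ∧ dist c q = r ∧
            ∃ w ∈ W, dist c w < r) ↔
          ((f p).1 - (f q).1) * ((f p).2 - (f q).2) < 0) := by
  obtain ⟨f, g, h⟩ := rlz_all (W := W) (P := P)
    (fun p hp q hq => hcoord p (Finset.mem_union_left _ hp) q (Finset.mem_union_left _ hq))
    (fun p hp w hw => hcoord w (Finset.mem_union_right _ hw) p (Finset.mem_union_left _ hp))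
  refine ⟨fun p => (f p, g p), ?_, ?_⟩
  · intro p hp q hq e
    by_contra hpq
    obtain ⟨h1, h2⟩ := h p hp q hq hpq
    obtain ⟨e1, e2⟩ := Prod.mk.inj e
    rw [e1, sub_self, zero_mul] at h1 h2
    by_cases ha : SqAdj W p q
    · exact lt_irrefl _ (h1 ha)
    · exact lt_irrefl _ (h2 ha)
  · intro p hp q hq hpq
    obtain ⟨h1, h2⟩ := h p hp q hq hpq
    refine ⟨fun ha => h1 ha, fun hlt => ?_⟩
    by_contra hn
    exact lt_asymm hlt (h2 hn)
end

section
/- A single witness placed below and to the left of a point set realizes the incomparability (permutation) graph of the dominance order: let P be a finite set in ℝ × ℝ whose points have pairwise distinct first coordinates and pairwise distinct second coordinates, and let w ∈ ℝ × ℝ satisfy w.1 < p.1 and w.2 < p.2 for every p ∈ P. Then for all distinct p, q ∈ P, p and q are adjacent in the square graph SG⁺(P,{w}) if and only if (p.1 − q.1) · (p.2 − q.2) < 0. -/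
lemma sg_fwd (p q w c : ℝ × ℝ) (r : ℝ) (h1 : w.1 < p.1) (h2 : w.2 < p.2)
    (h3 : p.1 < q.1) (h4 : p.2 < q.2) (hp : dist c p = r) (hq : dist c q = r)
    (hw : dist c w < r) : False := by
  have hlt : dist c p < r := by
    have hq' := hq.le
    rw [Prod.dist_eq, max_le_iff, Real.dist_eq, Real.dist_eq, abs_le, abs_le] at hq'
    rw [Prod.dist_eq, max_lt_iff, Real.dist_eq, Real.dist_eq, abs_lt, abs_lt] at hw ⊢
    obtain ⟨⟨_, _⟩, _, _⟩ := hq'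
    obtain ⟨⟨_, _⟩, _, _⟩ := hw
    refine ⟨⟨?_, ?_⟩, ?_, ?_⟩ <;> linarith
  linarith

lemma sg_bwd (p q w : ℝ × ℝ) (h1 : w.1 < p.1) (h2 : w.2 < q.2)
    (h3 : p.1 < q.1) (h4 : q.2 < p.2) :
    ∃ (c : ℝ × ℝ) (r : ℝ), dist c p = r ∧ dist c q = r ∧ dist c w < r := by
  obtain ⟨r, hr⟩ : ∃ r, r = (q.1 - w.1) + (p.2 - w.2) := ⟨_, rfl⟩
  refine ⟨(q.1 - r, p.2 - r), r, ?_, ?_, ?_⟩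
  · rw [Prod.dist_eq, Real.dist_eq, Real.dist_eq]
    have : |p.2 - r - p.2| = r := by
      rw [abs_of_nonpos] <;> linarith
    simp only [this]
    apply max_eq_right
    rw [abs_le]; constructor <;> linarith
  · rw [Prod.dist_eq, Real.dist_eq, Real.dist_eq]
    have : |q.1 - r - q.1| = r := by
      rw [abs_of_nonpos] <;> linarith
    simp only [this]
    apply max_eq_left
    rw [abs_le]; constructor <;> linarith
  · rw [Prod.dist_eq, max_lt_iff, Real.dist_eq, Real.dist_eq, abs_lt, abs_lt]
    refine ⟨⟨?_, ?_⟩, ?_, ?_⟩ <;> simp only <;> linarith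

/-- A single witness `w` below and to the left of all points of `P` realizes
the incomparability graph of the dominance order: two distinct points `p, q`
of `P` are adjacent in `SG⁺(P, {w})` (some axis-aligned square, a sup-distance
ball in `ℝ × ℝ`, has `p` and `q` on its boundary and `w` in its interior) iff
`(p.1 - q.1) * (p.2 - q.2) < 0`. -/
theorem single_witness_squareGraph (P : Finset (ℝ × ℝ))
    (hcoord : ∀ a ∈ P, ∀ b ∈ P, a ≠ b → a.1 ≠ b.1 ∧ a.2 ≠ b.2)
    (w : ℝ × ℝ) (hw : ∀ p ∈ P, w.1 < p.1 ∧ w.2 < p.2) :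
    ∀ p ∈ P, ∀ q ∈ P, p ≠ q →
      ((∃ (c : ℝ × ℝ) (r : ℝ), dist c p = r ∧ dist c q = r ∧ dist c w < r) ↔
        (p.1 - q.1) * (p.2 - q.2) < 0) := by
  intro p hp q hq hpq
  obtain ⟨n1, n2⟩ := hcoord p hp q hq hpq
  obtain ⟨a1, a2⟩ := hw p hp
  obtain ⟨b1, b2⟩ := hw q hq
  rcases lt_or_gt_of_ne n1 with h1 | h1 <;> rcases lt_or_gt_of_ne n2 with h2 | h2
  · refine ⟨fun ⟨c, r, x, y, z⟩ => (sg_fwd p q w c r a1 a2 h1 h2 x y z).elim, fun h => ?_⟩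
    nlinarith [mul_pos (sub_pos.2 h1) (sub_pos.2 h2)]
  · refine ⟨fun _ => mul_neg_of_neg_of_pos (sub_neg.2 h1) (sub_pos.2 h2), fun _ => ?_⟩
    exact sg_bwd p q w a1 b2 h1 h2
  · refine ⟨fun _ => mul_neg_of_pos_of_neg (sub_pos.2 h1) (sub_neg.2 h2), fun _ => ?_⟩
    obtain ⟨c, r, x, y, z⟩ := sg_bwd q p w b1 a2 h1 h2
    exact ⟨c, r, y, x, z⟩
  · refine ⟨fun ⟨c, r, x, y, z⟩ => (sg_fwd q p w c r b1 b2 h1 h2 y x z).elim, fun h => ?_⟩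
    nlinarith [mul_pos (sub_pos.2 h1) (sub_pos.2 h2)]
end

section
/- Let P be a finite set of n points in the Euclidean plane, and let (cᵢ, rᵢ)_{i ∈ I} be a finite family of disks with rᵢ > 0 whose open disks (open balls Metric.ball cᵢ rᵢ) are pairwise disjoint, and such that the bounding circle Metric.sphere cᵢ rᵢ of each disk contains at least two points of P. Then |I| ≤ n. -/
lemma inner_le_aux {E : Type*} [NormedAddCommGroup E] [InnerProductSpace ℝ E] (u v : E)
    (h : ‖u‖ + ‖v‖ ≤ ‖u - v‖) : inner ℝ u v ≤ -(‖u‖ * ‖v‖) := by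
  have h1 := norm_sub_sq_real u v
  have h2 : (‖u‖ + ‖v‖) ^ 2 ≤ ‖u - v‖ ^ 2 := by gcongr
  nlinarith

lemma three_aux {E : Type*} [NormedAddCommGroup E] [InnerProductSpace ℝ E] (u v w : E)
    (hu : 0 < ‖u‖) (hv : 0 < ‖v‖) (hw : 0 < ‖w‖)
    (h1 : ‖u‖ + ‖v‖ ≤ ‖u - v‖) (h2 : ‖u‖ + ‖w‖ ≤ ‖u - w‖) (h3 : ‖v‖ + ‖w‖ ≤ ‖v - w‖) :
    False := by
  have i1 := inner_le_aux u v h1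
  have i2 := inner_le_aux u w h2
  have i3 := inner_le_aux v w h3
  have key := real_inner_self_nonneg
    (x := (‖v‖ * ‖w‖) • u + (‖u‖ * ‖w‖) • v + (‖u‖ * ‖v‖) • w)
  simp only [inner_add_left, inner_add_right, real_inner_smul_left, real_inner_smul_right,
    real_inner_self_eq_norm_sq, norm_smul, norm_mul, norm_norm] at key
  have s1 := real_inner_comm v u
  have s2 := real_inner_comm w u
  have s3 := real_inner_comm w v
  simp only [s1, s2, s3] at key i1 i2 i3
  generalize ‖u‖ = a at *
  generalize ‖v‖ = b at *
  generalize ‖w‖ = c at *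
  have j1 := mul_le_mul_of_nonneg_left i1 (by positivity : 0 ≤ a * b * c ^ 2)
  have j2 := mul_le_mul_of_nonneg_left i2 (by positivity : 0 ≤ a * c * b ^ 2)
  have j3 := mul_le_mul_of_nonneg_left i3 (by positivity : 0 ≤ b * c * a ^ 2)
  have : 0 < (a * b * c) ^ 2 := by positivity
  nlinarith

/-- A family of disks with pairwise disjoint open disks, each of whose bounding
circles passes through at least two points of a finite planar set `P`, has at
most `|P|` members. -/
theorem disjoint_disks_card_le {ι : Type*} (P : Finset (EuclideanSpace ℝ (Fin 2)))
    (I : Finset ι) (c : ι → EuclideanSpace ℝ (Fin 2)) (r : ι → ℝ)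
    (hr : ∀ i ∈ I, 0 < r i)
    (hdisj : ∀ i ∈ I, ∀ j ∈ I, i ≠ j →
      Disjoint (Metric.ball (c i) (r i)) (Metric.ball (c j) (r j)))
    (hpts : ∀ i ∈ I, ∃ p ∈ P, ∃ q ∈ P, p ≠ q ∧
      p ∈ Metric.sphere (c i) (r i) ∧ q ∈ Metric.sphere (c i) (r i)) :
    I.card ≤ P.card := by
  classical
  have key := Finset.card_mul_le_card_mul (s := I) (t := P) (m := 2) (n := 2)
    (fun i p => p ∈ Metric.sphere (c i) (r i)) ?_ ?_
  · omega
  · intro i hi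
    obtain ⟨p, hp, q, hq, hpq, h1, h2⟩ := hpts i hi
    refine (Finset.card_pair hpq).symm.le.trans (Finset.card_le_card ?_)
    intro x hx
    rw [Finset.mem_insert, Finset.mem_singleton] at hx
    rw [Finset.mem_bipartiteAbove]
    rcases hx with rfl | rfl
    · exact ⟨hp, h1⟩
    · exact ⟨hq, h2⟩
  · intro p hp
    by_contra! hcon
    obtain ⟨i, j, k, hi, hj, hk, hij, hik, hjk⟩ := Finset.two_lt_card_iff.1 hcon
    rw [Finset.mem_bipartiteBelow] at hi hj hk
    have hn : ∀ i, p ∈ Metric.sphere (c i) (r i) → ‖c i - p‖ = r i := by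
      intro i h
      rw [← dist_eq_norm, dist_comm]
      exact h
    have hd : ∀ i j, (i ∈ I ∧ p ∈ Metric.sphere (c i) (r i)) →
        (j ∈ I ∧ p ∈ Metric.sphere (c j) (r j)) → i ≠ j →
        ‖c i - p‖ + ‖c j - p‖ ≤ ‖(c i - p) - (c j - p)‖ := by
      intro i j hi hj hij
      rw [hn i hi.2, hn j hj.2, sub_sub_sub_cancel_right, ← dist_eq_norm]
      exact (disjoint_ball_ball_iff (hr i hi.1) (hr j hj.1)).1 (hdisj i hi.1 j hj.1 hij)
    refine three_aux (c i - p) (c j - p) (c k - p) ?_ ?_ ?_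
      (hd i j hi hj hij) (hd i k hi hk hik) (hd j k hj hk hjk)
    · rw [hn i hi.2]; exact hr i hi.1
    · rw [hn j hj.2]; exact hr j hj.1
    · rw [hn k hk.2]; exact hr k hk.1
end

section
/- Stabbing Delaunay edges suffices to stab all disks: let P and W be finite sets in the Euclidean plane. Call p, p' ∈ P Delaunay neighbors if there exist c and r with dist(c,p) = dist(c,p') = r and dist(c,x) ≥ r for every x ∈ P. Suppose that for every pair p, p' of distinct Delaunay neighbors in P, every disk through p and p' contains a witness, i.e., for all c, r with dist(c,p) = dist(c,p') = r there exists w ∈ W with dist(c,w) < r. Then for every pair of distinct points p, q ∈ P and every c, r with dist(c,p) = dist(c,q) = r, there exists w ∈ W with dist(c,w) < r. -/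
/-- Two points of `P` are Delaunay neighbors iff some disk through them has no
point of `P` in its interior. -/
def DelaunayNbr (P : Finset (EuclideanSpace ℝ (Fin 2)))
    (p p' : EuclideanSpace ℝ (Fin 2)) : Prop :=
  ∃ (c : EuclideanSpace ℝ (Fin 2)) (r : ℝ),
    dist c p = r ∧ dist c p' = r ∧ ∀ x ∈ P, r ≤ dist c x

theorem key_expand (p c x : EuclideanSpace ℝ (Fin 2)) (t : ℝ) :
    dist (p + t • (c - p)) x ^ 2 = ‖x - p‖ ^ 2 - 2 * t * inner ℝ (x - p) (c - p)
      + (t * dist c p) ^ 2 := by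
  have e : p + t • (c - p) - x = t • (c - p) - (x - p) := by abel
  rw [dist_eq_norm, dist_eq_norm, e, norm_sub_sq_real, norm_smul, inner_smul_left,
    real_inner_comm, mul_pow, mul_pow, Real.norm_eq_abs, sq_abs]
  simp
  ring

/-- If every disk through a pair of distinct Delaunay neighbors of `P` contains
a witness of `W` in its interior, then every disk through any pair of distinct
points of `P` contains a witness of `W` in its interior. -/
theorem stabbing_delaunay_edges_suffices
    (P W : Finset (EuclideanSpace ℝ (Fin 2)))
    (h : ∀ p ∈ P, ∀ p' ∈ P, p ≠ p' → DelaunayNbr P p p' →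
      ∀ (c : EuclideanSpace ℝ (Fin 2)) (r : ℝ), dist c p = r → dist c p' = r →
        ∃ w ∈ W, dist c w < r) :
    ∀ p ∈ P, ∀ q ∈ P, p ≠ q →
      ∀ (c : EuclideanSpace ℝ (Fin 2)) (r : ℝ), dist c p = r → dist c q = r →
        ∃ w ∈ W, dist c w < r := by
  classical
  intro p hp q hq hpq c r hcp hcq
  have hr : 0 ≤ r := hcp ▸ dist_nonneg
  let f : EuclideanSpace ℝ (Fin 2) → ℝ :=
    fun x => ‖x - p‖ ^ 2 / (2 * inner ℝ (x - p) (c - p))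
  have hex : ∀ x, dist c x ^ 2 = ‖x - p‖ ^ 2 - 2 * inner ℝ (x - p) (c - p) + r ^ 2 := by
    intro x
    have := key_expand p c x 1
    simpa [hcp] using this
  have hpos : ∀ x, x ≠ p → 0 < ‖x - p‖ ^ 2 := by
    intro x hx
    have : 0 < ‖x - p‖ := norm_pos_iff.mpr (sub_ne_zero.mpr hx)
    positivity
  have hin : ∀ x, x ≠ p → dist c x ≤ r →
      ‖x - p‖ ^ 2 ≤ 2 * inner ℝ (x - p) (c - p) := by
    intro x hx hd
    have h1 := hex x
    have h2 : dist c x ^ 2 ≤ r ^ 2 := pow_le_pow_left₀ dist_nonneg hd 2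
    linarith
  obtain ⟨x, hxS, hmin⟩ := Finset.exists_min_image
    (P.filter (fun x => x ≠ p ∧ dist c x ≤ r)) f
    ⟨q, Finset.mem_filter.mpr ⟨hq, hpq.symm, hcq.le⟩⟩
  obtain ⟨hxP, hxp, hxr⟩ := Finset.mem_filter.mp hxS
  have hx1 := hin x hxp hxr
  have hx0 := hpos x hxp
  have hI : 0 < 2 * inner ℝ (x - p) (c - p) := lt_of_lt_of_le hx0 hx1
  obtain ⟨t, ht⟩ : ∃ t, t = f x := ⟨_, rfl⟩
  have ht0 : 0 < t := by rw [ht]; exact div_pos hx0 hI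
  have ht1 : t ≤ 1 := by rw [ht]; exact (div_le_one hI).mpr hx1
  have htx : ‖x - p‖ ^ 2 = t * (2 * inner ℝ (x - p) (c - p)) := by
    rw [ht]; exact (div_mul_cancel₀ _ hI.ne').symm
  have htr : 0 ≤ t * r := mul_nonneg ht0.le hr
  have hcc : dist c (p + t • (c - p)) = (1 - t) * r := by
    have e : c - (p + t • (c - p)) = (1 - t) • (c - p) := by
      rw [sub_smul, one_smul]; abel
    rw [dist_eq_norm, e, norm_smul, ← dist_eq_norm c p, hcp, Real.norm_eq_abs,
      abs_of_nonneg (by linarith)]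
  have hd1 : dist (p + t • (c - p)) p = t * r := by
    have := key_expand p c p t
    rw [hcp] at this
    apply (sq_eq_sq₀ dist_nonneg htr).mp
    rw [this]; simp
  have hd2 : dist (p + t • (c - p)) x = t * r := by
    have := key_expand p c x t
    rw [hcp] at this
    apply (sq_eq_sq₀ dist_nonneg htr).mp
    rw [this, htx]; ring
  have hsub : ∀ y, dist (p + t • (c - p)) y < t * r → dist c y < r := by
    intro y hy
    have := dist_triangle c (p + t • (c - p)) y
    rw [hcc] at this
    linarith
  have hD : DelaunayNbr P p x := by
    refine ⟨p + t • (c - p), t * r, hd1, hd2, ?_⟩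
    intro y hy
    by_contra! hlt
    have hyp : y ≠ p := by
      rintro rfl
      exact absurd hd1 hlt.ne
    have hyr := (hsub y hlt).le
    have hm := hmin y (Finset.mem_filter.mpr ⟨hy, hyp, hyr⟩)
    have hy1 := hin y hyp hyr
    have hyI : 0 < 2 * inner ℝ (y - p) (c - p) := lt_of_lt_of_le (hpos y hyp) hy1
    rw [← ht] at hm
    have hm2 := (le_div_iff₀ hyI).mp hm
    have hk := key_expand p c y t
    rw [hcp] at hk
    have hs : dist (p + t • (c - p)) y ^ 2 < (t * r) ^ 2 :=
      pow_lt_pow_left₀ hlt dist_nonneg (by norm_num)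
    linarith
  obtain ⟨w, hw, hwd⟩ := h p hp x hxP hxp.symm hD _ _ hd1 hd2
  exact ⟨w, hw, hsub w hwd⟩
end

section
/- At most 2n − 2 stabbing points always suffice for disks: for every finite set P of n ≥ 2 points in the Euclidean plane with no three points of P collinear, there exists a finite set W ⊂ ℝ² with |W| ≤ 2n − 2 such that for every pair of distinct points p, q ∈ P and every c ∈ ℝ², r ≥ 0 with dist(c,p) = dist(c,q) = r, there exists w ∈ W with dist(c,w) < r (every disk whose bounding circle passes through two points of P covers a witness; equivalently DG⁻(P,W) has no edges). -/
lemma stab_aux (c p : EuclideanSpace ℝ (Fin 2)) (a b : ℝ)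
    (h : a ^ 2 + b ^ 2 < 2 * (a * (c 0 - p 0) + b * (c 1 - p 1))) :
    dist c (p + !₂[a, b]) < dist c p := by
  rw [EuclideanSpace.dist_eq, EuclideanSpace.dist_eq]
  apply Real.sqrt_lt_sqrt (by positivity)
  simp only [Fin.sum_univ_two, Real.dist_eq, sq_abs]
  simp
  nlinarith

lemma stab_dir (P : Finset (EuclideanSpace ℝ (Fin 2))) :
    ∃ t : ℝ, ∀ p ∈ P, ∀ q ∈ P, p ≠ q → p 0 + t * p 1 ≠ q 0 + t * q 1 := by
  classical
  obtain ⟨t, ht⟩ := Infinite.exists_notMem_finset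
    ((P ×ˢ P).image (fun z => -(z.1 0 - z.2 0) / (z.1 1 - z.2 1)))
  refine ⟨t, fun p hp q hq hpq h => ?_⟩
  by_cases h1 : p 1 = q 1
  · apply hpq
    ext i
    fin_cases i
    · simp only [h1] at h
      simpa using h
    · exact h1
  · apply ht
    refine Finset.mem_image.2 ⟨(p, q), Finset.mem_product.2 ⟨hp, hq⟩, ?_⟩
    have : p 1 - q 1 ≠ 0 := sub_ne_zero.2 h1
    field_simp
    linarith

lemma stab_eps (P : Finset (EuclideanSpace ℝ (Fin 2)))
    (f : EuclideanSpace ℝ (Fin 2) → ℝ) :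
    ∃ d : ℝ, 0 < d ∧ ∀ p ∈ P, ∀ q ∈ P, f p < f q → d < f q - f p := by
  have h : ∀ᶠ d in nhdsWithin (0 : ℝ) (Set.Ioi 0),
      ∀ p ∈ P, ∀ q ∈ P, f p < f q → d < f q - f p := by
    rw [Filter.eventually_all_finset]
    intro p _
    rw [Filter.eventually_all_finset]
    intro q _
    rw [Filter.eventually_imp_distrib_left]
    intro hlt
    exact (eventually_lt_nhds (sub_pos.2 hlt)).filter_mono nhdsWithin_le_nhds
  obtain ⟨d, hd, hd0⟩ := (h.and self_mem_nhdsWithin).exists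
  exact ⟨d, hd0, hd⟩

/-- At most `2n - 2` stabbing points suffice for disks: for any finite planar
set `P` of `n ≥ 2` points with no three collinear, there is a set `W` of at
most `2n - 2` witnesses such that every disk whose bounding circle passes
through two distinct points of `P` contains a witness in its interior
(i.e., `DG⁻(P, W)` has no edges). -/
theorem stabbing_disks_upper_bound (P : Finset (EuclideanSpace ℝ (Fin 2)))
    (n : ℕ) (hn : P.card = n) (h2 : 2 ≤ n)
    (hcol : ∀ p ∈ P, ∀ q ∈ P, ∀ s ∈ P, p ≠ q → p ≠ s → q ≠ s →
      ¬ Collinear ℝ ({p, q, s} : Set (EuclideanSpace ℝ (Fin 2)))) :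
    ∃ W : Finset (EuclideanSpace ℝ (Fin 2)), W.card ≤ 2 * n - 2 ∧
      ∀ p ∈ P, ∀ q ∈ P, p ≠ q →
        ∀ (c : EuclideanSpace ℝ (Fin 2)) (r : ℝ), 0 ≤ r →
          dist c p = r → dist c q = r → ∃ w ∈ W, dist c w < r := by
  classical
  obtain ⟨t, ht⟩ := stab_dir P
  set f : EuclideanSpace ℝ (Fin 2) → ℝ := fun p => p 0 + t * p 1 with hf
  obtain ⟨d, hd, hdP⟩ := stab_eps P f
  have hne : P.Nonempty := Finset.card_pos.1 (by omega)
  obtain ⟨T, hT, hTm⟩ := P.exists_max_image f hne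
  obtain ⟨B, hB, hBm⟩ := P.exists_min_image f hne
  have hpos : 0 < 1 + t ^ 2 := by positivity
  obtain ⟨e, he, hed⟩ : ∃ e : ℝ, 0 < e ∧ e * (1 + t ^ 2) = d :=
    ⟨d / (1 + t ^ 2), by positivity, by field_simp⟩
  refine ⟨(P.erase T).image (fun p => p + !₂[e, e * t]) ∪
    (P.erase B).image (fun p => p + !₂[-e, -(e * t)]), ?_, ?_⟩
  · refine (Finset.card_union_le _ _).trans ?_
    have h1 := Finset.card_image_le (s := P.erase T) (f := fun p => p + !₂[e, e * t])
    have h3 := Finset.card_image_le (s := P.erase B) (f := fun p => p + !₂[-e, -(e * t)])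
    rw [Finset.card_erase_of_mem hT] at h1
    rw [Finset.card_erase_of_mem hB] at h3
    omega
  · have key : ∀ p ∈ P, ∀ q ∈ P, f p < f q → ∀ (c : EuclideanSpace ℝ (Fin 2)) (r : ℝ),
        dist c p = r → dist c q = r →
        ∃ w ∈ (P.erase T).image (fun p => p + !₂[e, e * t]) ∪
          (P.erase B).image (fun p => p + !₂[-e, -(e * t)]), dist c w < r := by
      intro p hp q hq hlt c r hcp hcq
      by_cases hc : f p + d / 2 < f c
      · refine ⟨p + !₂[e, e * t], Finset.mem_union_left _ (Finset.mem_image.2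
          ⟨p, Finset.mem_erase.2 ⟨?_, hp⟩, rfl⟩), ?_⟩
        · rintro rfl
          exact absurd (hTm q hq) (not_le.2 hlt)
        · rw [← hcp]
          apply stab_aux
          have : 0 < e * (f c - f p - d / 2) := mul_pos he (by linarith)
          rw [← hed] at this
          simp only [hf] at this
          nlinarith
      · refine ⟨q + !₂[-e, -(e * t)], Finset.mem_union_right _ (Finset.mem_image.2
          ⟨q, Finset.mem_erase.2 ⟨?_, hq⟩, rfl⟩), ?_⟩
        · rintro rfl
          exact absurd (hBm p hp) (not_le.2 hlt)
        · rw [← hcq]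
          apply stab_aux
          have h5 := hdP p hp q hq hlt
          have : 0 < e * (f q - f c - d / 2) := mul_pos he (by linarith)
          rw [← hed] at this
          simp only [hf] at this
          nlinarith
    intro p hp q hq hpq c r _ hcp hcq
    rcases lt_or_gt_of_ne (ht p hp q hq hpq) with h | h
    · exact key p hp q hq h c r hcp hcq
    · exact key q hq p hp h c r hcq hcp
end

section
/- At least n stabbing points can be necessary for disks: for every n ≥ 3 there exists a set P of n points in the Euclidean plane such that every finite set W ⊂ ℝ² with the property that for all distinct p, q ∈ P and all c, r with dist(c,p) = dist(c,q) = r there exists w ∈ W with dist(c,w) < r, must satisfy |W| ≥ n. -/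
noncomputable def ptE (c t : ℝ) : EuclideanSpace ℝ (Fin 2) := !₂[c * Real.cos t, c * Real.sin t]

lemma ptE_dist (c d s t : ℝ) :
    dist (ptE c s) (ptE d t) = √(c ^ 2 + d ^ 2 - 2 * c * d * Real.cos (s - t)) := by
  rw [EuclideanSpace.dist_eq]
  congr 1
  simp only [ptE, Fin.sum_univ_two, Real.dist_eq, sq_abs]
  simp
  rw [Real.cos_sub]
  nlinarith [Real.sin_sq_add_cos_sq s, Real.sin_sq_add_cos_sq t]

lemma ptE_dist_same (c s t : ℝ) (hc : 0 ≤ c) :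
    dist (ptE c s) (ptE c t) = c * (2 * |Real.sin ((s - t) / 2)|) := by
  rw [ptE_dist]
  have h : Real.cos (s - t) = 1 - 2 * Real.sin ((s - t) / 2) ^ 2 := by
    have := Real.cos_two_mul ((s - t) / 2)
    rw [show 2 * ((s - t) / 2) = s - t by ring] at this
    nlinarith [Real.sin_sq_add_cos_sq ((s - t) / 2)]
  rw [h, ← Real.sqrt_sq (by positivity : 0 ≤ c * (2 * |Real.sin ((s - t) / 2)|))]
  congr 1
  rw [mul_pow, mul_pow, sq_abs]; ring

lemma ptE_dist_tan (s t δ : ℝ) (h : s - t = δ ∨ s - t = -δ) (hδ : 0 ≤ Real.sin δ) :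
    dist (ptE 1 s) (ptE (Real.cos δ) t) = Real.sin δ := by
  have hc : Real.cos (s - t) = Real.cos δ := by
    rcases h with h | h <;> simp [h]
  rw [ptE_dist, hc]
  rw [show 1 ^ 2 + Real.cos δ ^ 2 - 2 * 1 * Real.cos δ * Real.cos δ = Real.sin δ ^ 2 by
    nlinarith [Real.sin_sq_add_cos_sq δ]]
  exact Real.sqrt_sq hδ

lemma sin_mul_ge (n m : ℕ) (hn : 3 ≤ n) (h1 : 1 ≤ m) (h2 : m + 1 ≤ n) :
    Real.sin (Real.pi / n) ≤ Real.sin (Real.pi / n * m) := by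
  have hn0 : (0:ℝ) < n := by positivity
  have hpi := Real.pi_pos
  have hd : 0 < Real.pi / n := by positivity
  have hdn : Real.pi / n * n = Real.pi := by field_simp
  have h1' : (1:ℝ) ≤ m := by exact_mod_cast h1
  have h2' : (m:ℝ) + 1 ≤ n := by exact_mod_cast h2
  set d := Real.pi / n
  have a1 : d ≤ d * m := by nlinarith
  have a2 : d * m ≤ Real.pi - d := by nlinarith
  rcases le_total (d * m) (Real.pi / 2) with h | h
  · exact Real.sin_le_sin_of_le_of_le_pi_div_two (by linarith) h a1
  · rw [← Real.sin_pi_sub (d * m)]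
    exact Real.sin_le_sin_of_le_of_le_pi_div_two (by linarith) (by linarith) (by linarith)

lemma abs_sin_ge (n j k : ℕ) (hn : 3 ≤ n) (hj : j < n) (hk : k < n) (hjk : j ≠ k) :
    Real.sin (Real.pi / n) ≤ |Real.sin (Real.pi / n * ((j:ℝ) - k))| := by
  rcases lt_or_gt_of_ne hjk with h | h
  · have := sin_mul_ge n (k - j) hn (by omega) (by omega)
    rw [Nat.cast_sub h.le] at this
    rw [show Real.pi / n * ((j:ℝ) - k) = -(Real.pi / n * ((k:ℝ) - j)) by ring, Real.sin_neg, abs_neg]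
    exact this.trans (le_abs_self _)
  · have := sin_mul_ge n (j - k) hn (by omega) (by omega)
    rw [Nat.cast_sub h.le] at this
    exact this.trans (le_abs_self _)

/-- At least `n` stabbing points can be necessary for disks: for every `n ≥ 3`
there is a set `P` of `n` points in the plane such that any finite set `W`
stabbing every disk through two distinct points of `P` satisfies `|W| ≥ n`. -/
theorem stabbing_disks_lower_bound (n : ℕ) (hn : 3 ≤ n) :
    ∃ P : Finset (EuclideanSpace ℝ (Fin 2)), P.card = n ∧
      ∀ W : Finset (EuclideanSpace ℝ (Fin 2)),
        (∀ p ∈ P, ∀ q ∈ P, p ≠ q →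
          ∀ (c : EuclideanSpace ℝ (Fin 2)) (r : ℝ), dist c p = r → dist c q = r →
            ∃ w ∈ W, dist c w < r) →
        n ≤ W.card := by
  classical
  have hn0 : (0:ℝ) < n := by positivity
  have hn3 : (3:ℝ) ≤ n := by exact_mod_cast hn
  have hpi := Real.pi_pos
  obtain ⟨d, hd⟩ : ∃ d, d = Real.pi / n := ⟨_, rfl⟩
  have hd0 : 0 < d := by rw [hd]; positivity
  have hdn : d * n = Real.pi := by rw [hd]; field_simp
  have hd2 : d < Real.pi / 2 := by nlinarith
  have hs : 0 < Real.sin d := Real.sin_pos_of_pos_of_lt_pi hd0 (by linarith)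
  have hc : 0 < Real.cos d := Real.cos_pos_of_mem_Ioo ⟨by linarith, hd2⟩
  let p : ℕ → EuclideanSpace ℝ (Fin 2) := fun k => ptE (Real.cos d) (d * (2 * k + 1))
  let v : ℕ → EuclideanSpace ℝ (Fin 2) := fun k => ptE 1 (d * (2 * k + 2))
  have hpd : ∀ j k, dist (p j) (p k) = Real.cos d * (2 * |Real.sin (d * ((j:ℝ) - k))|) := by
    intro j k
    simp only [p]
    rw [ptE_dist_same _ _ _ hc.le]
    congr 4; ring
  have hvd : ∀ j k, dist (v j) (v k) = 2 * |Real.sin (d * ((j:ℝ) - k))| := by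
    intro j k
    simp only [v]
    rw [ptE_dist_same _ _ _ zero_le_one, one_mul]
    congr 3; ring
  have hinj : Set.InjOn p (Finset.range n) := by
    intro j hj k hk h
    by_contra hjk
    have h1 := abs_sin_ge n j k hn (by simpa using hj) (by simpa using hk) hjk
    rw [← hd] at h1
    have h2 := hpd j k
    rw [h, dist_self] at h2
    have : 0 < Real.cos d * (2 * |Real.sin (d * ((j:ℝ) - k))|) :=
      mul_pos hc (by linarith)
    linarith
  have hp0 : p n = p 0 := by
    have : d * (2 * (n:ℝ) + 1) = d + 2 * Real.pi := by rw [← hdn]; ring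
    simp only [p, ptE, this, Real.cos_add_two_pi, Real.sin_add_two_pi]
    simp
  refine ⟨(Finset.range n).image p, ?_, ?_⟩
  · rw [Finset.card_image_of_injOn hinj, Finset.card_range]
  intro W hW
  have hmem : ∀ k ≤ n, p k ∈ (Finset.range n).image p := by
    intro k hk
    rcases hk.lt_or_eq with h | h
    · exact Finset.mem_image_of_mem _ (Finset.mem_range.2 h)
    · rw [h, hp0]
      exact Finset.mem_image_of_mem _ (Finset.mem_range.2 (by omega))
  have key : ∀ k : Fin n, ∃ w ∈ W, dist (v k) w < Real.sin d := by
    intro k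
    refine hW (p k) (hmem _ k.2.le) (p (k + 1)) (hmem _ k.2) ?_ (v k) _ ?_ ?_
    · intro h
      have h2 := hpd k (k + 1)
      rw [h, dist_self] at h2
      push_cast at h2
      rw [show d * ((k:ℝ) - (k + 1)) = -d by ring, Real.sin_neg, abs_neg, abs_of_pos hs] at h2
      have : 0 < Real.cos d * (2 * Real.sin d) := by positivity
      linarith
    · exact ptE_dist_tan _ _ _ (Or.inl (by ring)) hs.le
    · exact ptE_dist_tan _ _ _ (Or.inr (by push_cast; ring)) hs.le
  choose f hf hfd using key
  have finj : Function.Injective f := by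
    intro j k h
    by_contra hjk
    have h1 := abs_sin_ge n j k hn j.2 k.2 (fun h => hjk (Fin.ext h))
    rw [← hd] at h1
    have h2 := dist_triangle_right (v j) (v k) (f j)
    have h3 := hfd j
    have h4 := hfd k
    rw [← h] at h4
    rw [hvd] at h2
    linarith
  have := Finset.card_le_card_of_injOn (s := Finset.univ) (t := W) f (fun k _ => hf k) finj.injOn
  simpa using this
end

section
/- For every natural number t ≥ 1 there exists a finite set P ⊂ ℝ × ℝ with |P| = 4t² + t, whose points have pairwise distinct first coordinates and pairwise distinct second coordinates, together with a family of 5t² − t axis-aligned squares (given by centers cᵢ and radii rᵢ > 0 for the sup distance) whose interiors (open sup-distance balls) are pairwise disjoint, such that the boundary (sup-distance sphere) of each square contains at least two points of P. -/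
/-- first coordinate of the point `k` of row `j` -/
def sqX (t j k : ℤ) : ℤ := 8 * t * k + j * (16 * t + 1)

/-- second coordinate of the point `k` of row `j` -/
def sqY (t j k : ℤ) : ℤ :=
  j * (12 * t + 2) + k + (if k % 4 = 0 then 0 else if k % 4 = 2 then 8 * t else 4 * t)

/-- two integer squares (lower left corner, side) separated by an axis-parallel line -/
def sqSep (X Y s X' Y' s' : ℤ) : Prop :=
  X + s ≤ X' ∨ X' + s' ≤ X ∨ Y + s ≤ Y' ∨ Y' + s' ≤ Y

/-- an integer point on the boundary of an integer square -/
def sqOn (X Y s x y : ℤ) : Prop :=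
  X ≤ x ∧ x ≤ X + s ∧ Y ≤ y ∧ y ≤ Y + s ∧ (x = X ∨ x = X + s ∨ y = Y ∨ y = Y + s)

/-- the center of an integer square -/
noncomputable def sqC (X Y s : ℤ) : ℝ × ℝ := ((X : ℝ) + s / 2, (Y : ℝ) + s / 2)

theorem sqSep_disjoint {X Y s X' Y' s' : ℤ} (h : sqSep X Y s X' Y' s') :
    Disjoint (Metric.ball (sqC X Y s) ((s : ℝ) / 2))
      (Metric.ball (sqC X' Y' s') ((s' : ℝ) / 2)) := by
  rw [Set.disjoint_left]
  rintro ⟨x, y⟩ h1 h2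
  simp only [sqC, Metric.mem_ball, Prod.dist_eq, Real.dist_eq, max_lt_iff, abs_lt] at h1 h2
  obtain ⟨⟨a, b⟩, c, d⟩ := h1
  obtain ⟨⟨a', b'⟩, c', d'⟩ := h2
  rcases h with h | h | h | h
  all_goals
    have h' := (Int.cast_le (R := ℝ)).2 h
    push_cast at h'
    linarith

theorem sqOn_sphere {X Y s x y : ℤ} (h : sqOn X Y s x y) :
    ((x : ℝ), (y : ℝ)) ∈ Metric.sphere (sqC X Y s) ((s : ℝ) / 2) := by
  obtain ⟨h1, h2, h3, h4, h5⟩ := h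
  rify at h1 h2 h3 h4 h5
  simp only [sqC, Metric.mem_sphere, Prod.dist_eq, Real.dist_eq]
  have hx : |(x : ℝ) - (X + s / 2)| ≤ s / 2 := by rw [abs_le]; constructor <;> linarith
  have hy : |(y : ℝ) - (Y + s / 2)| ≤ s / 2 := by rw [abs_le]; constructor <;> linarith
  apply le_antisymm (max_le hx hy)
  rw [le_max_iff, le_abs, le_abs]
  rcases h5 with h | h | h | h
  · left; right; linarith
  · left; left; linarith
  · right; right; linarith
  · right; left; linarith

theorem sqX_inj {t j k j' k' : ℤ} (hj : 0 ≤ j) (hjt : j < t) (hj' : 0 ≤ j') (hjt' : j' < t)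
    (h : sqX t j k = sqX t j' k') : j = j' ∧ k = k' := by
  unfold sqX at h
  have e : t * (8 * (k - k') + 16 * (j - j')) = j' - j := by linarith
  have hz : 8 * (k - k') + 16 * (j - j') = 0 := by
    rcases lt_trichotomy (8 * (k - k') + 16 * (j - j')) 0 with h0 | h0 | h0
    · nlinarith
    · exact h0
    · nlinarith
  rw [hz] at e
  omega

theorem row_mono {D j j' : ℤ} (hD : 0 ≤ D) (h : j < j') : j * D + D ≤ j' * D := by
  nlinarith

theorem sqY_inj {t j k j' k' : ℤ} (hk : 0 ≤ k) (hkt : k ≤ 4 * t) (hk' : 0 ≤ k')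
    (hkt' : k' ≤ 4 * t) (h : sqY t j k = sqY t j' k') : j = j' ∧ k = k' := by
  unfold sqY at h
  have hD : 0 ≤ 12 * t + 2 := by omega
  rcases lt_trichotomy j j' with h0 | h0 | h0
  · have := row_mono hD h0
    generalize j * (12 * t + 2) = a at *
    generalize j' * (12 * t + 2) = b at *
    split_ifs at h <;> omega
  · subst h0
    generalize j * (12 * t + 2) = a at *
    split_ifs at h <;> omega
  · have := row_mono hD h0
    generalize j * (12 * t + 2) = a at *
    generalize j' * (12 * t + 2) = b at *
    split_ifs at h <;> omega

/-- bottom of the row square -/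
def sqB (t j k : ℤ) : ℤ := j * (12 * t + 2) + k + k % 2

/-- bottom of the link square -/
def sqL (t j i : ℤ) : ℤ := j * (12 * t + 2) + 4 * i + 2 + 8 * t

theorem row_row {t j k j' k' : ℤ} (hk : 0 ≤ k) (hkt : k < 4 * t) (hk' : 0 ≤ k')
    (hkt' : k' < 4 * t) (h : ¬ (j = j' ∧ k = k')) :
    sqSep (sqX t j k) (sqB t j k) (8 * t) (sqX t j' k') (sqB t j' k') (8 * t) := by
  have hD : 0 ≤ 12 * t + 2 := by omega
  unfold sqSep sqB
  rcases lt_trichotomy j j' with h0 | h0 | h0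
  · have := row_mono hD h0
    right; right; left
    omega
  · subst h0
    unfold sqX
    rcases lt_or_gt_of_ne (show k ≠ k' from fun e => h ⟨rfl, e⟩) with h1 | h1
    · left; nlinarith
    · right; left; nlinarith
  · have := row_mono hD h0
    right; right; right
    omega

theorem link_row {t j i j' k' : ℤ} (hi : 0 ≤ i) (hit : i < t) (hk' : 0 ≤ k')
    (hkt' : k' < 4 * t) :
    sqSep (sqX t j (4 * i + 2)) (sqL t j i) (4 * t) (sqX t j' k') (sqB t j' k') (8 * t) := by
  have hD : 0 ≤ 12 * t + 2 := by omega
  unfold sqSep sqB sqL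
  rcases lt_trichotomy j j' with h0 | h0 | h0
  · rcases lt_or_ge (j + 1) j' with h1 | h1
    · have := row_mono hD h1
      have e : (j + 1) * (12 * t + 2) = j * (12 * t + 2) + (12 * t + 2) := by ring
      right; right; left
      omega
    · have : j' = j + 1 := by omega
      subst this
      have e : (j + 1) * (12 * t + 2) = j * (12 * t + 2) + (12 * t + 2) := by ring
      rcases le_or_gt k' (4 * i - 2) with h2 | h2
      · right; left
        unfold sqX
        nlinarith
      · right; right; left
        omega
  · subst h0
    rcases lt_trichotomy k' (4 * i + 2) with h1 | h1 | h1
    · right; left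
      unfold sqX
      nlinarith
    · right; right; right
      omega
    · left
      unfold sqX
      nlinarith
  · have := row_mono hD h0
    right; right; right
    omega

theorem link_link {t j i j' i' : ℤ} (hi : 0 ≤ i) (hit : i < t) (hi' : 0 ≤ i')
    (hit' : i' < t) (h : ¬ (j = j' ∧ i = i')) :
    sqSep (sqX t j (4 * i + 2)) (sqL t j i) (4 * t)
      (sqX t j' (4 * i' + 2)) (sqL t j' i') (4 * t) := by
  have hD : 0 ≤ 12 * t + 2 := by omega
  unfold sqSep sqL
  rcases lt_trichotomy j j' with h0 | h0 | h0
  · have := row_mono hD h0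
    right; right; left
    omega
  · subst h0
    unfold sqX
    rcases lt_or_gt_of_ne (show i ≠ i' from fun e => h ⟨rfl, e⟩) with h1 | h1
    · left; nlinarith
    · right; left; nlinarith
  · have := row_mono hD h0
    right; right; right
    omega

theorem row_on_left {t j k : ℤ} (hk : 0 ≤ k) (hkt : k < 4 * t) :
    sqOn (sqX t j k) (sqB t j k) (8 * t) (sqX t j k) (sqY t j k) := by
  unfold sqOn sqB sqY
  refine ⟨le_rfl, by omega, ?_, ?_, Or.inl rfl⟩ <;> split_ifs <;> omega

theorem row_on_right {t j k : ℤ} (hk : 0 ≤ k) (hkt : k < 4 * t) :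
    sqOn (sqX t j k) (sqB t j k) (8 * t) (sqX t j (k + 1)) (sqY t j (k + 1)) := by
  have e : sqX t j (k + 1) = sqX t j k + 8 * t := by unfold sqX; ring
  unfold sqOn sqB sqY
  rw [e]
  refine ⟨by omega, le_rfl, ?_, ?_, Or.inr (Or.inl rfl)⟩ <;> split_ifs <;> omega

theorem link_on_bot {t j i : ℤ} (hi : 0 ≤ i) (hit : i < t) :
    sqOn (sqX t j (4 * i + 2)) (sqL t j i) (4 * t)
      (sqX t j (4 * i + 2)) (sqY t j (4 * i + 2)) := by
  unfold sqOn sqL sqY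
  refine ⟨le_rfl, by omega, ?_, ?_, Or.inl rfl⟩ <;> split_ifs <;> omega

theorem link_on_top {t j i : ℤ} (hi : 0 ≤ i) (hit : i < t) :
    sqOn (sqX t j (4 * i + 2)) (sqL t j i) (4 * t)
      (sqX t (j + 1) (4 * i)) (sqY t (j + 1) (4 * i)) := by
  have e : sqX t (j + 1) (4 * i) = sqX t j (4 * i + 2) + 1 := by unfold sqX; ring
  have e' : sqY t (j + 1) (4 * i) = sqL t j i + 4 * t := by
    unfold sqY sqL
    rw [if_pos (by omega)]
    ring
  unfold sqOn
  rw [e, e']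
  omega

/-- the real point `k` of row `j` -/
noncomputable def sqP (t j k : ℤ) : ℝ × ℝ := ((sqX t j k : ℝ), (sqY t j k : ℝ))

/-- For every `t ≥ 1` there is a set `P` of `4t² + t` points in `ℝ × ℝ` with
pairwise distinct first and second coordinates, together with a family of
`5t² − t` axis-aligned squares (sup-distance balls) with pairwise disjoint
interiors, each having at least two points of `P` on its boundary. -/
theorem disjoint_squares_construction (t : ℕ) (ht : 1 ≤ t) :
    ∃ (P : Finset (ℝ × ℝ)) (c : Fin (5 * t ^ 2 - t) → ℝ × ℝ)
      (r : Fin (5 * t ^ 2 - t) → ℝ),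
      P.card = 4 * t ^ 2 + t ∧
      (∀ a ∈ P, ∀ b ∈ P, a ≠ b → a.1 ≠ b.1 ∧ a.2 ≠ b.2) ∧
      (∀ i, 0 < r i) ∧
      (∀ i j, i ≠ j → Disjoint (Metric.ball (c i) (r i)) (Metric.ball (c j) (r j))) ∧
      (∀ i, ∃ p ∈ P, ∃ q ∈ P, p ≠ q ∧
        p ∈ Metric.sphere (c i) (r i) ∧ q ∈ Metric.sphere (c i) (r i)) := by
  classical
  let I := (Fin t × Fin (4 * t)) ⊕ (Fin (t - 1) × Fin t)
  have hcard : Fintype.card I = 5 * t ^ 2 - t := by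
    obtain ⟨s, rfl⟩ : ∃ s, t = s + 1 := ⟨t - 1, by omega⟩
    simp only [I, Fintype.card_sum, Fintype.card_prod, Fintype.card_fin, Nat.add_sub_cancel]
    apply Nat.eq_sub_of_add_eq
    ring
  let e : Fin (5 * t ^ 2 - t) ≃ I := (Fintype.equivFinOfCardEq hcard).symm
  let pt : Fin t × Fin (4 * t + 1) → ℝ × ℝ := fun a => sqP t (a.1 : ℕ) (a.2 : ℕ)
  have hne : ∀ a b, a ≠ b → (pt a).1 ≠ (pt b).1 ∧ (pt a).2 ≠ (pt b).2 := by
    rintro ⟨j, k⟩ ⟨j', k'⟩ hab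
    have hj := j.2
    have hj' := j'.2
    have hk := k.2
    have hk' := k'.2
    constructor
    · intro h
      have h' : sqX t (j : ℕ) (k : ℕ) = sqX t (j' : ℕ) (k' : ℕ) := Int.cast_injective (α := ℝ) h
      obtain ⟨h1, h2⟩ := sqX_inj (by omega) (by omega) (by omega) (by omega) h'
      exact hab (Prod.ext (Fin.ext (by exact_mod_cast h1)) (Fin.ext (by exact_mod_cast h2)))
    · intro h
      have h' : sqY t (j : ℕ) (k : ℕ) = sqY t (j' : ℕ) (k' : ℕ) := Int.cast_injective (α := ℝ) h
      obtain ⟨h1, h2⟩ := sqY_inj (by omega) (by omega) (by omega) (by omega) h'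
      exact hab (Prod.ext (Fin.ext (by exact_mod_cast h1)) (Fin.ext (by exact_mod_cast h2)))
  have hinj : Function.Injective pt := by
    intro a b h
    by_contra hab
    exact (hne a b hab).1 (by rw [h])
  let cx : I → ℤ := Sum.elim (fun a => sqX t (a.1 : ℕ) (a.2 : ℕ))
    (fun a => sqX t (a.1 : ℕ) (4 * ((a.2 : ℕ) : ℤ) + 2))
  let cy : I → ℤ := Sum.elim (fun a => sqB t (a.1 : ℕ) (a.2 : ℕ))
    (fun a => sqL t (a.1 : ℕ) (a.2 : ℕ))
  let sd : I → ℤ := Sum.elim (fun _ => 8 * (t : ℤ)) (fun _ => 4 * (t : ℤ))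
  have hsep : ∀ a b, a ≠ b → Disjoint
      (Metric.ball (sqC (cx a) (cy a) (sd a)) ((sd a : ℝ) / 2))
      (Metric.ball (sqC (cx b) (cy b) (sd b)) ((sd b : ℝ) / 2)) := by
    rintro (⟨j, k⟩ | ⟨j, k⟩) (⟨j', k'⟩ | ⟨j', k'⟩) hab
    · have hk := k.2
      have hk' := k'.2
      apply sqSep_disjoint
      apply row_row (by omega) (by omega) (by omega) (by omega)
      rintro ⟨h1, h2⟩
      exact hab (congrArg Sum.inl
        (Prod.ext (Fin.ext (by exact_mod_cast h1)) (Fin.ext (by exact_mod_cast h2))))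
    · have hk := k.2
      have hk' := k'.2
      apply Disjoint.symm
      apply sqSep_disjoint
      exact link_row (by omega) (by omega) (by omega) (by omega)
    · have hk := k.2
      have hk' := k'.2
      apply sqSep_disjoint
      exact link_row (by omega) (by omega) (by omega) (by omega)
    · have hk := k.2
      have hk' := k'.2
      apply sqSep_disjoint
      apply link_link (by omega) (by omega) (by omega) (by omega)
      rintro ⟨h1, h2⟩
      exact hab (congrArg Sum.inr
        (Prod.ext (Fin.ext (by exact_mod_cast h1)) (Fin.ext (by exact_mod_cast h2))))
  have hon : ∀ a, ∃ p q, p ≠ q ∧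
      pt p ∈ Metric.sphere (sqC (cx a) (cy a) (sd a)) ((sd a : ℝ) / 2) ∧
      pt q ∈ Metric.sphere (sqC (cx a) (cy a) (sd a)) ((sd a : ℝ) / 2) := by
    rintro (⟨j, k⟩ | ⟨j, k⟩)
    · have hk := k.2
      refine ⟨(j, ⟨k, by omega⟩), (j, ⟨k + 1, by omega⟩), ?_, ?_, ?_⟩
      · simp
      · exact sqOn_sphere (row_on_left (by omega) (by omega))
      · have := sqOn_sphere (row_on_right (t := t) (j := (j : ℕ)) (k := (k : ℕ))
          (by omega) (by omega))
        simpa [pt, sqP, cx, cy, sd] using this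
    · have hk := k.2
      have hj := j.2
      refine ⟨(⟨j, by omega⟩, ⟨4 * k + 2, by omega⟩), (⟨j + 1, by omega⟩, ⟨4 * k, by omega⟩),
        ?_, ?_, ?_⟩
      · simp
      · have := sqOn_sphere (link_on_bot (t := t) (j := (j : ℕ)) (i := (k : ℕ))
          (by omega) (by omega))
        simpa [pt, sqP, cx, cy, sd] using this
      · have := sqOn_sphere (link_on_top (t := t) (j := (j : ℕ)) (i := (k : ℕ))
          (by omega) (by omega))
        simpa [pt, sqP, cx, cy, sd] using this
  refine ⟨Finset.univ.image pt, fun i => sqC (cx (e i)) (cy (e i)) (sd (e i)),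
    fun i => (sd (e i) : ℝ) / 2, ?_, ?_, ?_, ?_, ?_⟩
  · rw [Finset.card_image_of_injective _ hinj]
    simp only [Finset.card_univ, Fintype.card_prod, Fintype.card_fin]
    ring
  · intro a ha b hb hab
    obtain ⟨a, -, rfl⟩ := Finset.mem_image.1 ha
    obtain ⟨b, -, rfl⟩ := Finset.mem_image.1 hb
    exact hne a b (fun h => hab (by rw [h]))
  · intro i
    have : ∀ a, 0 < sd a := by
      rintro (a | a)
      · show 0 < 8 * (t : ℤ)
        omega
      · show 0 < 4 * (t : ℤ)
        omega
    have h := (Int.cast_pos (R := ℝ)).2 (this (e i))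
    exact half_pos h
  · intro i j hij
    exact hsep _ _ (fun h => hij (e.injective h))
  · intro i
    obtain ⟨p, q, hpq, h1, h2⟩ := hon (e i)
    exact ⟨pt p, Finset.mem_image_of_mem _ (Finset.mem_univ _), pt q,
      Finset.mem_image_of_mem _ (Finset.mem_univ _), fun h => hpq (hinj h), h1, h2⟩
end

section
/- Many stabbing points can be necessary for squares: for every natural number t ≥ 1 there exists a finite set P ⊂ ℝ × ℝ with |P| = 4t² + t, whose points have pairwise distinct first coordinates and pairwise distinct second coordinates, such that every finite set W ⊂ ℝ × ℝ with the property that for all distinct p, q ∈ P and all c, r with dist∞(c,p) = dist∞(c,q) = r there exists w ∈ W with dist∞(c,w) < r (every axis-aligned square with two points of P on its boundary contains a witness in its interior), must satisfy |W| ≥ 5t² − t. -/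
noncomputable def ssF (k l : ℝ) : ℝ × ℝ := (k - √2 * l, k + √2 * l)

lemma ss_irr {k l k' l' : ℤ} (h : (k : ℝ) - √2 * l = k' - √2 * l') : k = k' ∧ l = l' := by
  have hl : l = l' := by
    by_contra hne
    have h0 : ((l - l' : ℤ) : ℝ) ≠ 0 := by
      exact_mod_cast sub_ne_zero.mpr hne
    refine irrational_sqrt_two ⟨((k - k' : ℤ) : ℚ) / ((l - l' : ℤ) : ℚ), ?_⟩
    push_cast at h0 ⊢
    rw [div_eq_iff h0]
    linarith
  subst hl
  refine ⟨?_, rfl⟩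
  have : (k : ℝ) = k' := by linarith
  exact_mod_cast this

lemma ss_irr1 {k l k' l' : ℕ} (h : (k : ℝ) - √2 * l = k' - √2 * l') : k = k' ∧ l = l' := by
  have := @ss_irr k l k' l' (by exact_mod_cast h)
  omega

lemma ss_irr2 {k l k' l' : ℕ} (h : (k : ℝ) + √2 * l = k' + √2 * l') : k = k' ∧ l = l' := by
  have := @ss_irr k (-l) k' (-l') (by push_cast; linarith)
  omega

lemma ss_s1 : (1 : ℝ) < √2 := by
  rw [Real.lt_sqrt] <;> norm_num

lemma ss_s2 : √2 < (2 : ℝ) := by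
  rw [Real.sqrt_lt'] <;> norm_num

lemma ss_ball {k l r : ℝ} {w : ℝ × ℝ} (h : dist (ssF k l) w < r) :
    (k - √2 * l - w.1 < r ∧ -r < k - √2 * l - w.1) ∧
    (k + √2 * l - w.2 < r ∧ -r < k + √2 * l - w.2) := by
  rw [Prod.dist_eq, max_lt_iff, Real.dist_eq, Real.dist_eq, abs_lt, abs_lt] at h
  simp only [ssF] at h
  tauto

lemma ss_h (k l a : ℝ) (ha : a = 1 / 2 ∨ a = -(1 / 2)) :
    dist (ssF k l) (ssF (k + a) l) = 1 / 2 := by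
  rw [Prod.dist_eq, Real.dist_eq, Real.dist_eq]
  simp only [ssF]
  rw [show k - √2 * l - (k + a - √2 * l) = -a by ring,
    show k + √2 * l - (k + a + √2 * l) = -a by ring, max_self, abs_neg]
  rcases ha with rfl | rfl <;> norm_num

lemma ss_v (k l a : ℝ) (ha : a = 1 / 2 ∨ a = -(1 / 2)) :
    dist (ssF k l) (ssF k (l + a)) = √2 / 2 := by
  have hs := ss_s1
  rw [Prod.dist_eq, Real.dist_eq, Real.dist_eq]
  simp only [ssF]
  rw [show k - √2 * l - (k - √2 * (l + a)) = √2 * a by ring,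
    show k + √2 * l - (k + √2 * (l + a)) = -(√2 * a) by ring, abs_neg, max_self, abs_mul,
    abs_of_pos (by linarith : (0 : ℝ) < √2)]
  rcases ha with rfl | rfl <;> norm_num <;> ring

lemma ss_int {a b : ℤ} (h1 : (a : ℝ) - b < 1) (h2 : (b : ℝ) - a < 1) : a = b := by
  have h1' : a - b < 1 := by exact_mod_cast h1
  have h2' : b - a < 1 := by exact_mod_cast h2
  omega

lemma ss_nat {a b : ℕ} (h1 : (a : ℝ) - b < 1) (h2 : (b : ℝ) - a < 1) : a = b := by
  have := @ss_int a b (by exact_mod_cast h1) (by exact_mod_cast h2)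
  omega

lemma ss_HH {k j k' j' : ℕ} {w : ℝ × ℝ}
    (h : dist (ssF (k + 1 / 2) (3 * j + 1)) w < 1 / 2)
    (h' : dist (ssF (k' + 1 / 2) (3 * j' + 1)) w < 1 / 2) : k = k' ∧ j = j' := by
  have hs := ss_s1
  obtain ⟨⟨a1, a2⟩, a3, a4⟩ := ss_ball h
  obtain ⟨⟨b1, b2⟩, b3, b4⟩ := ss_ball h'
  refine ⟨ss_nat (by linarith) (by linarith), ss_nat ?_ ?_⟩
  · by_contra! hc
    nlinarith
  · by_contra! hc
    nlinarith

lemma ss_VV {i l i' l' : ℕ} {w : ℝ × ℝ}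
    (h : dist (ssF (2 * i + 1) (l + 1 / 2)) w < √2 / 2)
    (h' : dist (ssF (2 * i' + 1) (l' + 1 / 2)) w < √2 / 2) : i = i' ∧ l = l' := by
  have hs := ss_s1
  have hs2 := ss_s2
  obtain ⟨⟨a1, a2⟩, a3, a4⟩ := ss_ball h
  obtain ⟨⟨b1, b2⟩, b3, b4⟩ := ss_ball h'
  refine ⟨ss_nat (by linarith) (by linarith), ss_nat ?_ ?_⟩
  · by_contra! hc
    nlinarith
  · by_contra! hc
    nlinarith

lemma ss_HV {k j i l : ℕ} {w : ℝ × ℝ}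
    (h : dist (ssF (k + 1 / 2) (3 * j + 1)) w < 1 / 2)
    (h' : dist (ssF (2 * i + 1) (l + 1 / 2)) w < √2 / 2) : False := by
  have hs := ss_s1
  obtain ⟨⟨a1, a2⟩, a3, a4⟩ := ss_ball h
  obtain ⟨⟨b1, b2⟩, b3, b4⟩ := ss_ball h'
  have hA : (2 * i + 1 : ℝ) ≤ k ∨ (k : ℝ) + 1 ≤ 2 * i + 1 := by
    have : 2 * i + 1 ≤ k ∨ k + 1 ≤ 2 * i + 1 := by omega
    exact_mod_cast this
  have hB : (3 * j + 1 : ℝ) ≤ l ∨ (l : ℝ) + 1 ≤ 3 * j + 1 := by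
    have : 3 * j + 1 ≤ l ∨ l + 1 ≤ 3 * j + 1 := by omega
    exact_mod_cast this
  rcases hA with hA | hA <;> rcases hB with hB | hB <;>
    have hC := mul_le_mul_of_nonneg_left hB (by linarith : (0 : ℝ) ≤ √2) <;> linarith

def ssI (t : ℕ) : Finset (ℕ × ℕ) :=
  (Finset.range (2 * t + 1) ×ˢ Finset.range (3 * t)).filter
    (fun x => x.1 % 2 = 1 ∨ x.2 % 3 = 1)

lemma ssI_card (t : ℕ) : (ssI t).card = 4 * t ^ 2 + t := by
  have h : ssI t = ((Finset.range (t + 1) ×ˢ Finset.range t).image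
        (fun x => (2 * x.1, 3 * x.2 + 1))) ∪
      ((Finset.range t ×ˢ Finset.range (3 * t)).image (fun x => (2 * x.1 + 1, x.2))) := by
    ext ⟨a, b⟩
    simp only [ssI, Finset.mem_filter, Finset.mem_product, Finset.mem_range, Finset.mem_union,
      Finset.mem_image, Prod.mk.injEq, Prod.exists]
    constructor
    · rintro ⟨⟨h1, h2⟩, h3⟩
      by_cases ha : a % 2 = 1
      · right
        exact ⟨a / 2, b, by omega, by omega, by omega⟩
      · left
        exact ⟨a / 2, b / 3, by omega, by omega, by omega⟩
    · rintro (⟨x, y, h1, h2, h3⟩ | ⟨x, y, h1, h2, h3⟩) <;> omega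
  rw [h, Finset.card_union_of_disjoint, Finset.card_image_of_injective,
    Finset.card_image_of_injective]
  · simp
    ring
  · rintro ⟨a, b⟩ ⟨c, d⟩ h
    simp only [Prod.mk.injEq] at h ⊢
    omega
  · rintro ⟨a, b⟩ ⟨c, d⟩ h
    simp only [Prod.mk.injEq] at h ⊢
    omega
  · rw [Finset.disjoint_left]
    rintro ⟨a, b⟩ h1 h2
    simp only [Finset.mem_image, Prod.mk.injEq, Prod.exists] at h1 h2
    obtain ⟨_, _, _, _, _⟩ := h1
    obtain ⟨_, _, _, _, _⟩ := h2
    omega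

/-- Many stabbing points can be necessary for squares: for every `t ≥ 1` there
is a set `P` of `4t² + t` points in `ℝ × ℝ` (with pairwise distinct first and
second coordinates) such that any finite set `W` stabbing every axis-aligned
square (sup-distance ball) with two distinct points of `P` on its boundary
satisfies `|W| ≥ 5t² − t`. -/
theorem stabbing_squares_lower_bound (t : ℕ) (ht : 1 ≤ t) :
    ∃ P : Finset (ℝ × ℝ), P.card = 4 * t ^ 2 + t ∧
      (∀ a ∈ P, ∀ b ∈ P, a ≠ b → a.1 ≠ b.1 ∧ a.2 ≠ b.2) ∧
      ∀ W : Finset (ℝ × ℝ),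
        (∀ p ∈ P, ∀ q ∈ P, p ≠ q →
          ∀ (c : ℝ × ℝ) (r : ℝ), dist c p = r → dist c q = r →
            ∃ w ∈ W, dist c w < r) →
        5 * t ^ 2 - t ≤ W.card := by
  classical
  have hinj : Function.Injective (fun x : ℕ × ℕ => ssF x.1 x.2) := by
    rintro ⟨a, b⟩ ⟨c, d⟩ h
    have := ss_irr1 (congrArg Prod.fst h)
    exact Prod.ext this.1 this.2
  refine ⟨(ssI t).image (fun x : ℕ × ℕ => ssF x.1 x.2), ?_, ?_, ?_⟩
  · rw [Finset.card_image_of_injective _ hinj, ssI_card]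
  · intro a ha b hb hab
    obtain ⟨⟨k, l⟩, -, rfl⟩ := Finset.mem_image.mp ha
    obtain ⟨⟨k', l'⟩, -, rfl⟩ := Finset.mem_image.mp hb
    constructor
    · intro h
      obtain ⟨rfl, rfl⟩ := ss_irr1 h
      exact hab rfl
    · intro h
      obtain ⟨rfl, rfl⟩ := ss_irr2 h
      exact hab rfl
  · intro W hW
    have key : ∀ k l k' l' : ℕ, (k, l) ∈ ssI t → (k', l') ∈ ssI t → (k, l) ≠ (k', l') →
        ∀ (c : ℝ × ℝ) (r : ℝ), dist c (ssF k l) = r → dist c (ssF k' l') = r →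
          ∃ w ∈ W, dist c w < r := by
      intro k l k' l' h1 h2 h3
      exact hW _ (Finset.mem_image_of_mem _ h1) _ (Finset.mem_image_of_mem _ h2)
        (fun h => h3 (hinj h))
    have hH : ∀ x : ℕ × ℕ, x.1 < 2 * t → x.2 < t →
        ∃ w ∈ W, dist (ssF (x.1 + 1 / 2) (3 * x.2 + 1)) w < 1 / 2 := by
      rintro ⟨k, j⟩ hk hj
      simp only at hk hj
      refine key k (3 * j + 1) (k + 1) (3 * j + 1) ?_ ?_ (by simp) _ _ ?_ ?_
      · simp [ssI]; omega
      · simp [ssI]; omega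
      · convert ss_h (k + 1 / 2) (3 * j + 1) (-(1 / 2)) (Or.inr rfl) using 3
        · ring
        · push_cast; ring
      · convert ss_h (k + 1 / 2) (3 * j + 1) (1 / 2) (Or.inl rfl) using 3
        · push_cast; ring
        · push_cast; ring
    have hV : ∀ x : ℕ × ℕ, x.1 < t → x.2 < 3 * t - 1 →
        ∃ w ∈ W, dist (ssF (2 * x.1 + 1) (x.2 + 1 / 2)) w < √2 / 2 := by
      rintro ⟨i, l⟩ hi hl
      simp only at hi hl
      refine key (2 * i + 1) l (2 * i + 1) (l + 1) ?_ ?_ (by simp) _ _ ?_ ?_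
      · simp [ssI]; omega
      · simp [ssI]; omega
      · convert ss_v (2 * i + 1) (l + 1 / 2) (-(1 / 2)) (Or.inr rfl) using 3
        · push_cast; ring
        · ring
      · convert ss_v (2 * i + 1) (l + 1 / 2) (1 / 2) (Or.inl rfl) using 3
        · push_cast; ring
        · push_cast; ring
    choose! f hfW hf using hH
    choose! g hgW hg using hV
    have hfi : Set.InjOn f (Finset.range (2 * t) ×ˢ Finset.range t : Finset (ℕ × ℕ)) := by
      intro x hx y hy h
      simp only [Finset.mem_coe, Finset.mem_product, Finset.mem_range] at hx hy
      have h1 := hf x hx.1 hx.2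
      have h2 := hf y hy.1 hy.2
      rw [h] at h1
      exact Prod.ext (ss_HH h1 h2).1 (ss_HH h1 h2).2
    have hgi : Set.InjOn g (Finset.range t ×ˢ Finset.range (3 * t - 1) : Finset (ℕ × ℕ)) := by
      intro x hx y hy h
      simp only [Finset.mem_coe, Finset.mem_product, Finset.mem_range] at hx hy
      have h1 := hg x hx.1 hx.2
      have h2 := hg y hy.1 hy.2
      rw [h] at h1
      exact Prod.ext (ss_VV h1 h2).1 (ss_VV h1 h2).2
    have hsub : (Finset.range (2 * t) ×ˢ Finset.range t).image f ∪
        (Finset.range t ×ˢ Finset.range (3 * t - 1)).image g ⊆ W := by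
      intro w hw
      simp only [Finset.mem_union, Finset.mem_image, Finset.mem_product, Finset.mem_range] at hw
      rcases hw with ⟨x, hx, rfl⟩ | ⟨x, hx, rfl⟩
      · exact hfW x hx.1 hx.2
      · exact hgW x hx.1 hx.2
    have hcard := Finset.card_le_card hsub
    rw [Finset.card_union_of_disjoint, Finset.card_image_of_injOn hfi,
      Finset.card_image_of_injOn hgi] at hcard
    · simp only [Finset.card_product, Finset.card_range] at hcard
      obtain ⟨m, hm⟩ : ∃ m, 3 * t - 1 = m := ⟨_, rfl⟩
      have hm' : m + 1 = 3 * t := by omega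
      rw [hm] at hcard
      have : 5 * t ^ 2 = 2 * t * t + t * m + t := by nlinarith
      omega
    · rw [Finset.disjoint_left]
      intro w h1 h2
      simp only [Finset.mem_image, Finset.mem_product, Finset.mem_range] at h1 h2
      obtain ⟨x, hx, rfl⟩ := h1
      obtain ⟨y, hy, hyx⟩ := h2
      have h3 := hg y hy.1 hy.2
      rw [hyx] at h3
      exact ss_HV (hf x hx.1 hx.2) h3
end

section
/- At most 2n − √n stabbing points suffice for all axis-aligned rectangles (and hence for all squares): let P be a finite set of n points in ℝ × ℝ with pairwise distinct first coordinates and pairwise distinct second coordinates. Then there exists a finite set W ⊂ ℝ × ℝ with |W| ≤ 2n − Nat.sqrt n such that for every pair of distinct points p, q ∈ P there exists w ∈ W with min(p.1, q.1) < w.1 < max(p.1, q.1) and min(p.2, q.2) < w.2 < max(p.2, q.2) (i.e., w lies in the interior of the axis-aligned rectangle having p and q as opposite corners). -/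
def stabD (s : ℝ) (p q : ℝ × ℝ) : Prop := p.1 < q.1 ∧ s * p.2 < s * q.2

lemma stab_eps_s16 (T : Finset ℝ) : ∃ ε : ℝ, 0 < ε ∧ ∀ t ∈ T, 0 < t → ε < t := by
  classical
  induction T using Finset.induction_on with
  | empty => exact ⟨1, one_pos, by simp⟩
  | insert a T _ ih =>
    obtain ⟨ε, h0, h⟩ := ih
    by_cases ha : 0 < a
    · refine ⟨min ε (a / 2), lt_min h0 (by linarith), ?_⟩
      intro t ht htp
      rcases Finset.mem_insert.1 ht with rfl | ht
      · exact lt_of_le_of_lt (min_le_right _ _) (by linarith)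
      · exact lt_of_le_of_lt (min_le_left _ _) (h t ht htp)
    · refine ⟨ε, h0, ?_⟩
      intro t ht htp
      rcases Finset.mem_insert.1 ht with rfl | ht
      · exact absurd htp ha
      · exact h t ht htp

lemma stab_eps2 (P : Finset (ℝ × ℝ)) (g : ℝ × ℝ → ℝ) :
    ∃ ε : ℝ, 0 < ε ∧ ∀ p ∈ P, ∀ q ∈ P, g p < g q → g p + ε < g q := by
  classical
  obtain ⟨ε, h0, h⟩ := stab_eps_s16 ((P ×ˢ P).image (fun x => g x.2 - g x.1))
  refine ⟨ε, h0, fun p hp q hq hpq => ?_⟩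
  have := h (g q - g p) (Finset.mem_image.2 ⟨(p, q), by simp [hp, hq], rfl⟩) (by linarith)
  linarith

lemma stab_half (P A : Finset (ℝ × ℝ)) (hA : A ⊆ P) (s : ℝ) (hs : s * s = 1)
    (hanti : ∀ p ∈ A, ∀ q ∈ A, ¬ stabD s p q) :
    ∃ W : Finset (ℝ × ℝ), W.card + A.card ≤ P.card ∧
      ∀ p ∈ P, ∀ q ∈ P, stabD s p q → ∃ w ∈ W, stabD s p w ∧ stabD s w q := by
  classical
  obtain ⟨ε₁, h1, h1'⟩ := stab_eps2 P (fun p => p.1)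
  obtain ⟨ε₂, h2, h2'⟩ := stab_eps2 P (fun p => s * p.2)
  let f : ℝ × ℝ → ℝ × ℝ := fun p =>
    if ∃ a ∈ A, stabD s a p then (p.1 - ε₁, p.2 - s * ε₂) else (p.1 + ε₁, p.2 + s * ε₂)
  refine ⟨(P \ A).image f, ?_, ?_⟩
  · have := Finset.card_sdiff_add_card_eq_card hA
    have := Finset.card_image_le (s := P \ A) (f := f)
    omega
  · intro p hp q hq hpq
    have e1 := h1' p hp q hq hpq.1
    have e2 := h2' p hp q hq hpq.2
    have hse : s * (s * ε₂) = ε₂ := by rw [← mul_assoc, hs, one_mul]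
    by_cases hqU : ∃ a ∈ A, stabD s a q
    · have hqA : q ∉ A := fun hqA => by
        obtain ⟨a, ha, h⟩ := hqU
        exact hanti a ha q hqA h
      refine ⟨f q, Finset.mem_image_of_mem _ (Finset.mem_sdiff.2 ⟨hq, hqA⟩), ?_⟩
      have hf : f q = (q.1 - ε₁, q.2 - s * ε₂) := if_pos hqU
      rw [hf]
      simp only [stabD, mul_sub, hse]
      refine ⟨⟨?_, ?_⟩, ?_, ?_⟩ <;> linarith
    · have hpU : ¬ ∃ a ∈ A, stabD s a p := by
        rintro ⟨a, ha, h⟩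
        exact hqU ⟨a, ha, h.1.trans hpq.1, h.2.trans hpq.2⟩
      have hpA : p ∉ A := fun hpA => hqU ⟨p, hpA, hpq⟩
      refine ⟨f p, Finset.mem_image_of_mem _ (Finset.mem_sdiff.2 ⟨hp, hpA⟩), ?_⟩
      have hf : f p = (p.1 + ε₁, p.2 + s * ε₂) := if_neg hpU
      rw [hf]
      simp only [stabD, mul_add, hse]
      refine ⟨⟨?_, ?_⟩, ?_, ?_⟩ <;> linarith

lemma stab_ES (b : ℕ) (hb : 0 < b) (a : ℕ) : ∀ S : Finset (ℝ × ℝ),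
    (∀ p ∈ S, ∀ q ∈ S, p ≠ q → p.1 ≠ q.1 ∧ p.2 ≠ q.2) → a * b ≤ S.card →
    (∃ C ⊆ S, a ≤ C.card ∧ ∀ p ∈ C, ∀ q ∈ C, ¬ stabD (-1) p q) ∨
    (∃ A ⊆ S, b ≤ A.card ∧ ∀ p ∈ A, ∀ q ∈ A, ¬ stabD 1 p q) := by
  classical
  induction a with
  | zero => intro S _ _; exact Or.inl ⟨∅, by simp⟩
  | succ a ih =>
    intro S hS hcard
    set M := S.filter (fun p => ∀ q ∈ S, ¬ stabD 1 q p) with hM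
    have hMS : M ⊆ S := Finset.filter_subset _ _
    by_cases hMb : b ≤ M.card
    · exact Or.inr ⟨M, hMS, hMb, fun p hp q hq => (Finset.mem_filter.1 hq).2 p (hMS hp)⟩
    have hc := Finset.card_sdiff_add_card_eq_card hMS
    rw [Nat.succ_mul] at hcard
    have hsub : S \ M ⊆ S := Finset.sdiff_subset
    rcases ih (S \ M) (fun p hp q hq => hS p (hsub hp) q (hsub hq)) (by omega) with
      ⟨C, hC, hCa, hCd⟩ | ⟨A, hA, h⟩
    swap
    · exact Or.inr ⟨A, hA.trans hsub, h⟩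
    left
    rcases C.eq_empty_or_nonempty with rfl | hne
    · have : 0 < S.card := by omega
      obtain ⟨x, hx⟩ := Finset.card_pos.1 this
      refine ⟨{x}, by simpa using hx, by simpa using hCa, ?_⟩
      intro p hp q hq h
      rw [Finset.mem_singleton] at hp hq
      subst hp; subst hq
      exact lt_irrefl _ h.1
    obtain ⟨c, hcC, hcmin⟩ := Finset.exists_min_image C (fun p => p.1) hne
    have hcS := hC hcC
    rw [Finset.mem_sdiff] at hcS
    have : ∃ m ∈ S, stabD 1 m c := by
      by_contra hcon
      push Not at hcon
      exact hcS.2 (Finset.mem_filter.2 ⟨hcS.1, hcon⟩)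
    obtain ⟨m, hmS, hmc⟩ := this
    have hmC : m ∉ C := fun h => absurd (hcmin m h) (not_le.2 hmc.1)
    have key : ∀ x ∈ C, m.1 < x.1 ∧ m.2 < x.2 := by
      intro x hx
      have h1 := hcmin x hx
      have h2 := hmc.1
      have h3 := hmc.2
      have h4 := hCd c hcC x hx
      refine ⟨by linarith, ?_⟩
      by_cases hxc : c = x
      · subst hxc; linarith
      · have h5 := (hS c hcS.1 x (hsub (hC hx)) hxc).1
        by_contra h6
        exact h4 ⟨lt_of_le_of_ne h1 h5, by linarith⟩
    refine ⟨insert m C, ?_, ?_, ?_⟩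
    · exact Finset.insert_subset hmS (hC.trans hsub)
    · rw [Finset.card_insert_of_notMem hmC]; omega
    · intro p hp q hq h
      rcases Finset.mem_insert.1 hp with rfl | hp2 <;>
        rcases Finset.mem_insert.1 hq with rfl | hq2
      · exact lt_irrefl _ h.1
      · have := (key q hq2).2
        have := h.2
        linarith
      · have := (key p hp2).1
        have := h.1
        linarith
      · exact hCd p hp2 q hq2 h

/-- At most `2n − √n` stabbing points suffice for all axis-aligned rectangles:
for a finite set `P` of points of `ℝ × ℝ` with pairwise distinct first and
second coordinates, there is a finite set `W` with `|W| ≤ 2·|P| − Nat.sqrt |P|`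
such that for every pair of distinct points `p, q ∈ P` some `w ∈ W` lies in
the interior of the axis-aligned rectangle with `p` and `q` as opposite
corners. -/
theorem stabbing_rectangles_upper_bound (P : Finset (ℝ × ℝ))
    (hcoord : ∀ a ∈ P, ∀ b ∈ P, a ≠ b → a.1 ≠ b.1 ∧ a.2 ≠ b.2) :
    ∃ W : Finset (ℝ × ℝ), W.card ≤ 2 * P.card - Nat.sqrt P.card ∧
      ∀ p ∈ P, ∀ q ∈ P, p ≠ q →
        ∃ w ∈ W, (min p.1 q.1 < w.1 ∧ w.1 < max p.1 q.1) ∧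
          (min p.2 q.2 < w.2 ∧ w.2 < max p.2 q.2) := by
  classical
  have hES : ∃ C ⊆ P, ∃ A ⊆ P, Nat.sqrt P.card ≤ C.card + A.card ∧
      (∀ p ∈ C, ∀ q ∈ C, ¬ stabD (-1) p q) ∧ (∀ p ∈ A, ∀ q ∈ A, ¬ stabD 1 p q) := by
    rcases Nat.eq_zero_or_pos (Nat.sqrt P.card) with h0 | h0
    · exact ⟨∅, by simp, ∅, by simp, by simp [h0], by simp, by simp⟩
    rcases stab_ES _ h0 (Nat.sqrt P.card) P hcoord (Nat.sqrt_le _) with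
      ⟨C, hC, h, h'⟩ | ⟨A, hA, h, h'⟩
    · exact ⟨C, hC, ∅, by simp, by simpa using h, h', by simp⟩
    · exact ⟨∅, by simp, A, hA, by simpa using h, by simp, h'⟩
  obtain ⟨C, hC, A, hA, hcard, hCd, hAd⟩ := hES
  obtain ⟨W₁, hW₁, h₁⟩ := stab_half P C hC (-1) (by norm_num) hCd
  obtain ⟨W₂, hW₂, h₂⟩ := stab_half P A hA 1 (by norm_num) hAd
  refine ⟨W₁ ∪ W₂, ?_, ?_⟩
  · have := Finset.card_union_le W₁ W₂
    omega
  have key : ∀ p ∈ P, ∀ q ∈ P, p ≠ q → p.1 < q.1 →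
        ∃ w ∈ W₁ ∪ W₂, (min p.1 q.1 < w.1 ∧ w.1 < max p.1 q.1) ∧
          (min p.2 q.2 < w.2 ∧ w.2 < max p.2 q.2) := by
    intro p hp q hq hpq hlt
    rcases lt_or_gt_of_ne (hcoord p hp q hq hpq).2 with h | h
    · obtain ⟨w, hw, ⟨a1, a2⟩, a3, a4⟩ := h₂ p hp q hq ⟨hlt, by linarith⟩
      refine ⟨w, Finset.mem_union_right _ hw, ?_⟩
      rw [min_eq_left hlt.le, max_eq_right hlt.le, min_eq_left h.le, max_eq_right h.le]
      exact ⟨⟨a1, a3⟩, by linarith, by linarith⟩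
    · obtain ⟨w, hw, ⟨a1, a2⟩, a3, a4⟩ := h₁ p hp q hq ⟨hlt, by linarith⟩
      refine ⟨w, Finset.mem_union_left _ hw, ?_⟩
      rw [min_eq_left hlt.le, max_eq_right hlt.le, min_eq_right h.le, max_eq_left h.le]
      exact ⟨⟨a1, a3⟩, by linarith, by linarith⟩
  intro p hp q hq hpq
  rcases lt_or_gt_of_ne (hcoord p hp q hq hpq).1 with h | h
  · exact key p hp q hq hpq h
  · rw [min_comm p.1, max_comm p.1, min_comm p.2, max_comm p.2]
    exact key q hq p hp hpq.symm h
end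

section
/- With at most one witness, the witness Delaunay graph is complete: for any two distinct points p, q in the Euclidean plane and any point w not in the open segment between p and q, there exist c ∈ ℝ² and r ≥ 0 with dist(c,p) = dist(c,q) = r and dist(c,w) ≥ r; that is, p and q are adjacent in the witness Delaunay graph DG⁻(P,{w}) for any vertex set P containing them. -/
/-- With a single witness `w` not on the open segment between two distinct
points `p` and `q` of the plane, there is a disk with `p` and `q` on its
bounding circle whose open disk does not contain `w`; hence `p` and `q` are
adjacent in any witness Delaunay graph `DG⁻(P, {w})`. -/
theorem single_witness_delaunay_complete (p q w : EuclideanSpace ℝ (Fin 2))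
    (hpq : p ≠ q) (hw : w ∉ openSegment ℝ p q) :
    ∃ (c : EuclideanSpace ℝ (Fin 2)) (r : ℝ), 0 ≤ r ∧
      dist c p = r ∧ dist c q = r ∧ r ≤ dist c w := by
  obtain ⟨u, hu⟩ : ∃ u, u = q 0 - p 0 := ⟨_, rfl⟩
  obtain ⟨v, hv⟩ : ∃ v, v = q 1 - p 1 := ⟨_, rfl⟩
  obtain ⟨x, hx⟩ : ∃ x, x = w 0 - p 0 := ⟨_, rfl⟩
  obtain ⟨y, hy⟩ : ∃ y, y = w 1 - p 1 := ⟨_, rfl⟩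
  have hN : 0 < u ^ 2 + v ^ 2 := by
    by_contra h
    have h1 : u = 0 := by nlinarith [sq_nonneg u, sq_nonneg v]
    have h2 : v = 0 := by nlinarith [sq_nonneg u, sq_nonneg v]
    apply hpq
    ext i
    fin_cases i
    · show p 0 = q 0
      linarith
    · show p 1 = q 1
      linarith
  have key : ∃ t : ℝ, 0 ≤ x ^ 2 + y ^ 2 - (x * u + y * v) - 2 * t * (y * u - x * v) := by
    by_cases hD : y * u - x * v = 0
    · refine ⟨0, ?_⟩
      obtain ⟨s, hs⟩ : ∃ s, s = (x * u + y * v) / (u ^ 2 + v ^ 2) := ⟨_, rfl⟩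
      have hxs : x = s * u := by
        rw [hs]; field_simp; linear_combination (-v) * hD
      have hys : y = s * v := by
        rw [hs]; field_simp; linear_combination u * hD
      have hs01 : ¬ (0 < s ∧ s < 1) := by
        rintro ⟨h0, h1⟩
        apply hw
        refine ⟨1 - s, s, by linarith, h0, by ring, ?_⟩
        ext i
        fin_cases i
        · show (1 - s) * p 0 + s * q 0 = w 0
          linear_combination hx - hxs - s * hu
        · show (1 - s) * p 1 + s * q 1 = w 1
          linear_combination hy - hys - s * hv
      have h3 : 0 ≤ s * (s - 1) := by
        by_cases h0 : 0 < s
        · have : 1 ≤ s := by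
            by_contra h; exact hs01 ⟨h0, not_le.mp h⟩
          nlinarith
        · nlinarith
      have := mul_nonneg h3 hN.le
      rw [hxs, hys]
      linarith
    · refine ⟨(x ^ 2 + y ^ 2 - (x * u + y * v)) / (2 * (y * u - x * v)), le_of_eq ?_⟩
      field_simp
      ring
  obtain ⟨t, ht⟩ := key
  refine ⟨!₂[p 0 + u / 2 - t * v, p 1 + v / 2 + t * u], _, dist_nonneg, rfl, ?_, ?_⟩
  · rw [EuclideanSpace.dist_eq, EuclideanSpace.dist_eq]
    congr 1
    simp only [Fin.sum_univ_two, Real.dist_eq, sq_abs]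
    simp
    rw [hu, hv]
    ring
  · rw [EuclideanSpace.dist_eq, EuclideanSpace.dist_eq]
    apply Real.sqrt_le_sqrt
    simp only [Fin.sum_univ_two, Real.dist_eq, sq_abs]
    simp
    have hw0 : w 0 = p 0 + x := by linarith
    have hw1 : w 1 = p 1 + y := by linarith
    rw [hw0, hw1]
    nlinarith
end

section
/- Two witnesses can make the square graph complete: for every finite set P ⊂ ℝ × ℝ whose points have pairwise distinct first coordinates and pairwise distinct second coordinates, there exist two points w₁, w₂ ∈ ℝ × ℝ such that every pair of distinct points p, q ∈ P is adjacent in the square graph SG⁺(P,{w₁,w₂}), i.e., there exist c and r with dist∞(c,p) = dist∞(c,q) = r and (dist∞(c,w₁) < r or dist∞(c,w₂) < r). -/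
/-- Two witnesses can make the square graph complete: for any finite set `P`
of points of `ℝ × ℝ` with pairwise distinct first and second coordinates,
there are two points `w₁, w₂` such that every pair of distinct points of `P`
is adjacent in `SG⁺(P, {w₁, w₂})`, i.e., some axis-aligned square
(sup-distance ball) has both points on its boundary and `w₁` or `w₂` in its
interior. -/
theorem two_witnesses_complete_squareGraph (P : Finset (ℝ × ℝ))
    (hcoord : ∀ a ∈ P, ∀ b ∈ P, a ≠ b → a.1 ≠ b.1 ∧ a.2 ≠ b.2) :
    ∃ w₁ w₂ : ℝ × ℝ, ∀ p ∈ P, ∀ q ∈ P, p ≠ q →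
      ∃ (c : ℝ × ℝ) (r : ℝ), dist c p = r ∧ dist c q = r ∧
        (dist c w₁ < r ∨ dist c w₂ < r) := by
  obtain ⟨M, hM0, hM⟩ := P.finite_toSet.isBounded.exists_pos_norm_lt
  have hb : ∀ p ∈ P, -M < p.1 ∧ p.1 < M ∧ -M < p.2 ∧ p.2 < M := by
    intro p hp
    have h := hM p (by simpa using hp)
    rw [Prod.norm_def, max_lt_iff, Real.norm_eq_abs, Real.norm_eq_abs, abs_lt, abs_lt] at h
    exact ⟨h.1.1, h.1.2, h.2.1, h.2.2⟩
  have key : ∀ p ∈ P, ∀ q ∈ P, p.1 < q.1 → p.2 ≠ q.2 →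
      ∃ (c : ℝ × ℝ) (r : ℝ), dist c p = r ∧ dist c q = r ∧
        (dist c (M, -M) < r ∨ dist c (M, M) < r) := by
    rintro ⟨a, b⟩ hp ⟨c, d⟩ hq h1 h2
    obtain ⟨p1, p2, p3, p4⟩ := hb _ hp
    obtain ⟨q1, q2, q3, q4⟩ := hb _ hq
    simp only at *
    have e1 : |a + 4 * M - a| = 4 * M := by
      rw [add_sub_cancel_left]; exact abs_of_pos (by linarith)
    have e2 : |a + 4 * M - c| ≤ 4 * M := by rw [abs_le]; constructor <;> linarith
    have e3 : |a + 4 * M - M| < 4 * M := by rw [abs_lt]; constructor <;> linarith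
    rcases lt_or_gt_of_ne h2 with h | h
    · refine ⟨(a + 4 * M, d - 4 * M), 4 * M, ?_, ?_, Or.inl ?_⟩ <;>
        simp only [Prod.dist_eq, Real.dist_eq]
      · rw [e1]; apply max_eq_left; rw [abs_le]; constructor <;> linarith
      · have : |d - 4 * M - d| = 4 * M := by
          rw [abs_of_nonpos] <;> linarith
        rw [this]; exact max_eq_right e2
      · refine max_lt e3 ?_
        rw [abs_lt]; constructor <;> linarith
    · refine ⟨(a + 4 * M, d + 4 * M), 4 * M, ?_, ?_, Or.inr ?_⟩ <;>
        simp only [Prod.dist_eq, Real.dist_eq]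
      · rw [e1]; apply max_eq_left; rw [abs_le]; constructor <;> linarith
      · have : |d + 4 * M - d| = 4 * M := by
          rw [abs_of_nonneg] <;> linarith
        rw [this]; exact max_eq_right e2
      · refine max_lt e3 ?_
        rw [abs_lt]; constructor <;> linarith
  refine ⟨(M, -M), (M, M), fun p hp q hq hpq => ?_⟩
  obtain ⟨h1, h2⟩ := hcoord p hp q hq hpq
  rcases lt_or_gt_of_ne h1 with h | h
  · exact key p hp q hq h h2
  · obtain ⟨c, r, x, y, z⟩ := key q hq p hp h h2.symm
    exact ⟨c, r, y, x, z⟩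
end
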